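/- arXiv:1501.00051 — 2 statements merged into one kernel-verified Lean document; each statement's English description precedes it below -/
import Mathlib

section
/- Fix m, n ≥ 1 and consider the edge-colored graph on S = [m]^n with an edge colored i joining s and F_i(s) whenever F_i(s) ≠ 0, for i ∈ [m−1]. Let C and C′ be two connected components whose unique vertices v ∈ C and v′ ∈ C′ satisfying E_i(v) = 0 = E_i(v′) for all i have equal weights w(v) = w(v′). Then there is a bijection between C and C′ that preserves edges together with their colors (an isomorphism of edge-colored graphs). Moreover, the weight w(v) of such a highest vertex v is a weakly decreasing sequence. -/
/-! ### Crystal operators on words -/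

/-- The number of `i`'s minus the number of `(i+1)`'s among the first `k` letters of `w`
(viewing each `i` as a closing parenthesis and each `i+1` as an opening parenthesis). -/
def prefD (i : ℕ) (w : List ℕ) (k : ℕ) : ℤ :=
  ((w.take k).count i : ℤ) - ((w.take k).count (i + 1) : ℤ)

/-- The number of `(i+1)`'s minus the number of `i`'s in the suffix of `w` starting at
position `k`. -/
def suffD (i : ℕ) (w : List ℕ) (k : ℕ) : ℤ :=
  ((w.drop k).count (i + 1) : ℤ) - ((w.drop k).count i : ℤ)

/-- Position `p` of `w` holds a letter `i` which, viewed as a closing parenthesis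
(each `i+1` being an opening parenthesis, all other letters ignored), is unmatched in the
usual parenthesis matching. -/
def IsUnmatchedClose (i : ℕ) (w : List ℕ) (p : ℕ) : Prop :=
  w[p]? = some i ∧ ∀ q ≤ p, prefD i w q < prefD i w (p + 1)

/-- Position `p` of `w` holds a letter `i+1` which, viewed as an opening parenthesis
(each `i` being a closing parenthesis, all other letters ignored), is unmatched in the
usual parenthesis matching. -/
def IsUnmatchedOpen (i : ℕ) (w : List ℕ) (p : ℕ) : Prop :=
  w[p]? = some (i + 1) ∧ ∀ q ≤ w.length, p < q → suffD i w q < suffD i w p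

instance (i : ℕ) (w : List ℕ) (p : ℕ) : Decidable (IsUnmatchedClose i w p) := by
  unfold IsUnmatchedClose; infer_instance

instance (i : ℕ) (w : List ℕ) (p : ℕ) : Decidable (IsUnmatchedOpen i w p) := by
  unfold IsUnmatchedOpen; infer_instance

/-- The (increasing) list of positions of unmatched `i`'s (closing parentheses) of `w`. -/
def unmatchedCloses (i : ℕ) (w : List ℕ) : List ℕ :=
  (List.range w.length).filter fun p => decide (IsUnmatchedClose i w p)

/-- The (increasing) list of positions of unmatched `(i+1)`'s (opening parentheses) of `w`. -/
def unmatchedOpens (i : ℕ) (w : List ℕ) : List ℕ :=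
  (List.range w.length).filter fun p => decide (IsUnmatchedOpen i w p)

/-- The crystal operator `F_i` on words: replace the rightmost unmatched `i` by `i+1`;
`none` (i.e. `0`) if every `i` is matched. -/
def Fop (i : ℕ) (w : List ℕ) : Option (List ℕ) :=
  match (unmatchedCloses i w).getLast? with
  | none => none
  | some p => some (w.set p (i + 1))

/-- The crystal operator `E_i` on words: replace the leftmost unmatched `i+1` by `i`;
`none` (i.e. `0`) if every `i+1` is matched. -/
def Eop (i : ℕ) (w : List ℕ) : Option (List ℕ) :=
  match (unmatchedOpens i w).head? with
  | none => none
  | some p => some (w.set p i)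

/-- `s` is a string over the alphabet `{1, …, m}`. -/
def IsWordOver (m : ℕ) (s : List ℕ) : Prop := ∀ x ∈ s, 1 ≤ x ∧ x ≤ m

/-- Two words are joined by an edge colored `i` (for some `i ∈ [m-1]`) of the crystal graph on
words: one is the image of the other under `F_i`. -/
def wordEdge (m : ℕ) (u v : List ℕ) : Prop :=
  ∃ i, 1 ≤ i ∧ i < m ∧ (Fop i u = some v ∨ Fop i v = some u)

/-- `v` lies in the connected component of `u` in the crystal graph on words. -/
def wordComp (m : ℕ) (u v : List ℕ) : Prop :=
  Relation.ReflTransGen (wordEdge m) u v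

/-! ### Recursive description of `F_i` -/

/-- Number of unmatched closing parentheses. -/
def phS (i : ℕ) : List ℕ → ℕ
  | [] => 0
  | x :: t => if x = i then phS i t + 1 else if x = i + 1 then phS i t - 1 else phS i t

/-- Contribution of a single letter. -/
def dS (i x : ℕ) : ℤ := if x = i then 1 else if x = i + 1 then -1 else 0

theorem prefD_zero (i : ℕ) (w : List ℕ) : prefD i w 0 = 0 := by simp [prefD]

theorem prefD_cons (i x : ℕ) (t : List ℕ) (k : ℕ) :
    prefD i (x :: t) (k + 1) = dS i x + prefD i t k := by
  simp only [prefD, dS, List.take_succ_cons, List.count_cons, beq_iff_eq]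
  split_ifs <;> push_cast <;> omega

theorem prefD_le (i : ℕ) (w : List ℕ) : ∀ k, prefD i w k ≤ phS i w := by
  induction w with
  | nil => intro k; simp [prefD, phS]
  | cons x t ih =>
    intro k
    cases k with
    | zero => rw [prefD_zero]; positivity
    | succ k =>
      rw [prefD_cons]
      have := ih k
      simp only [dS, phS]
      split_ifs <;> push_cast <;> omega

theorem close_shift (i x : ℕ) (t : List ℕ) (p : ℕ) (h : IsUnmatchedClose i t p)
    (h2 : prefD i t (p + 1) = phS i t) (h3 : 0 < dS i x + phS i t) :
    IsUnmatchedClose i (x :: t) (p + 1) ∧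
      prefD i (x :: t) (p + 1 + 1) = dS i x + phS i t := by
  refine ⟨⟨by simpa using h.1, ?_⟩, by rw [prefD_cons, h2]⟩
  intro q hq
  rw [prefD_cons]
  cases q with
  | zero => rw [prefD_zero]; omega
  | succ q =>
    rw [prefD_cons]
    have := h.2 q (by omega)
    omega

theorem exists_close (i : ℕ) (w : List ℕ) (h : phS i w ≠ 0) :
    ∃ p, IsUnmatchedClose i w p ∧ prefD i w (p + 1) = phS i w := by
  induction w with
  | nil => simp [phS] at h
  | cons x t ih =>
    by_cases h0 : phS i t = 0
    · have hx : x = i := by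
        by_contra hx
        simp [phS, hx, h0] at h
      subst hx
      refine ⟨0, ⟨by simp, ?_⟩, ?_⟩
      · intro q hq
        obtain rfl : q = 0 := by omega
        rw [prefD_zero, prefD_cons, prefD_zero]
        simp [dS]
      · rw [prefD_cons, prefD_zero]
        simp [dS, phS, h0]
    · obtain ⟨p, hp, hp2⟩ := ih h0
      have e : dS i x + (phS i t : ℤ) = phS i (x :: t) := by
        simp only [dS, phS]
        split_ifs <;> push_cast <;> omega
      have := close_shift i x t p hp hp2 (by rw [e]; omega)
      rw [e] at this
      exact ⟨p + 1, this⟩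

theorem mem_uc (i : ℕ) (w : List ℕ) (p : ℕ) :
    p ∈ unmatchedCloses i w ↔ IsUnmatchedClose i w p := by
  simp only [unmatchedCloses, List.mem_filter, List.mem_range, decide_eq_true_eq]
  constructor
  · exact fun h => h.2
  · intro h
    refine ⟨?_, h⟩
    have := h.1
    by_contra hc
    rw [List.getElem?_eq_none (by omega)] at this
    simp at this

theorem Fop_of_zero (i : ℕ) (w : List ℕ) (h : phS i w = 0) : Fop i w = none := by
  have : unmatchedCloses i w = [] := by
    rw [List.eq_nil_iff_forall_not_mem]
    intro p hp
    rw [mem_uc] at hp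
    have h1 := hp.2 0 (by omega)
    rw [prefD_zero] at h1
    have := prefD_le i w (p + 1)
    omega
  simp [Fop, this]

theorem Fop_of_close (i : ℕ) (w : List ℕ) (p : ℕ) (h : IsUnmatchedClose i w p)
    (h2 : prefD i w (p + 1) = phS i w) : Fop i w = some (w.set p (i + 1)) := by
  have hs : (unmatchedCloses i w).Pairwise (· < ·) :=
    List.Pairwise.filter _ List.pairwise_lt_range
  have hm := (mem_uc i w p).2 h
  have : (unmatchedCloses i w).getLast? = some p := by
    have hne : unmatchedCloses i w ≠ [] := List.ne_nil_of_mem hm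
    rw [List.getLast?_eq_some_getLast hne]
    congr 1
    set z := (unmatchedCloses i w).getLast hne with hz
    have hzm : z ∈ unmatchedCloses i w := List.getLast_mem hne
    have hzc := (mem_uc i w z).1 hzm
    have h3 : p ≤ z := by
      rw [← List.dropLast_append_getLast hne] at hm hs
      rw [List.pairwise_append] at hs
      rw [List.mem_append] at hm
      rcases hm with hm | hm
      · exact (hs.2.2 p hm z (by simp [hz])).le
      · simp at hm; omega
    by_contra hne2
    have := hzc.2 (p + 1) (by omega)
    have := prefD_le i w (z + 1)
    omega
  simp [Fop, this]

theorem Fop_cons (i x : ℕ) (t : List ℕ) :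
    Fop i (x :: t) = if x = i then
      (if phS i t = 0 then some ((i + 1) :: t) else (Fop i t).map (fun s => x :: s))
      else if x = i + 1 then (if phS i t ≤ 1 then none else (Fop i t).map (fun s => x :: s))
      else (Fop i t).map (fun s => x :: s) := by
  by_cases hz : phS i (x :: t) = 0
  · rw [Fop_of_zero _ _ hz]
    simp only [phS] at hz
    split_ifs at hz ⊢ <;> first | omega | simp [Fop_of_zero _ _ hz] | rfl
  · by_cases h0 : phS i t = 0
    · have hx : x = i := by
        by_contra hx
        simp [phS, hx, h0] at hz
      subst hx
      rw [if_pos rfl, if_pos h0]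
      rw [Fop_of_close _ _ 0]
      · simp
      · refine ⟨by simp, ?_⟩
        intro q hq
        obtain rfl : q = 0 := by omega
        rw [prefD_zero, prefD_cons, prefD_zero]
        simp [dS]
      · rw [prefD_cons, prefD_zero]
        simp [dS, phS, h0]
    · obtain ⟨p, hp, hp2⟩ := exists_close i t h0
      have e : dS i x + (phS i t : ℤ) = phS i (x :: t) := by
        simp only [dS, phS]
        split_ifs <;> push_cast <;> omega
      have h := close_shift i x t p hp hp2 (by rw [e]; omega)
      rw [e] at h
      rw [Fop_of_close _ _ _ h.1 h.2, Fop_of_close _ _ _ hp hp2]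
      simp only [phS] at hz
      split_ifs at hz ⊢ <;> first | omega | simp

theorem Fop_nil (i : ℕ) : Fop i [] = none := Fop_of_zero _ _ rfl

theorem Fop_some_of (i : ℕ) (t : List ℕ) (h : phS i t ≠ 0) : ∃ t', Fop i t = some t' := by
  obtain ⟨p, hp, hp2⟩ := exists_close i t h
  exact ⟨_, Fop_of_close _ _ _ hp hp2⟩

theorem Fop_length (i : ℕ) (t t' : List ℕ) (h : Fop i t = some t') : t'.length = t.length := by
  by_cases h0 : phS i t = 0
  · rw [Fop_of_zero _ _ h0] at h; simp at h
  · obtain ⟨p, hp, hp2⟩ := exists_close i t h0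
    rw [Fop_of_close _ _ _ hp hp2] at h
    simp at h
    rw [← h]; simp

/-! ### Crystal automorphisms -/

/-- `φ` is a bijection of words preserving `phS` and commuting with all `F_i`. -/
def IsAut (φ : Equiv.Perm (List ℕ)) : Prop :=
  (∀ i w, phS i (φ w) = phS i w) ∧ ∀ i w, Fop i (φ w) = (Fop i w).map φ

/-- Words related by a crystal automorphism. -/
def CEq (u v : List ℕ) : Prop := ∃ φ, IsAut φ ∧ φ u = v

theorem CEq.refl (u : List ℕ) : CEq u u := ⟨1, ⟨by simp, by simp⟩, rfl⟩

theorem IsAut.symm {φ : Equiv.Perm (List ℕ)} (h : IsAut φ) : IsAut φ.symm := by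
  refine ⟨fun i w => ?_, fun i w => ?_⟩
  · conv_rhs => rw [← φ.apply_symm_apply w, h.1]
  · conv_rhs => rw [← φ.apply_symm_apply w, h.2]
    simp

theorem CEq.symm {u v : List ℕ} (h : CEq u v) : CEq v u := by
  obtain ⟨φ, h, rfl⟩ := h
  exact ⟨φ.symm, h.symm, by simp⟩

theorem CEq.trans {u v w : List ℕ} (h : CEq u v) (h' : CEq v w) : CEq u w := by
  obtain ⟨φ, h, rfl⟩ := h
  obtain ⟨ψ, h', rfl⟩ := h'
  refine ⟨φ.trans ψ, ⟨fun i w => ?_, fun i w => ?_⟩, rfl⟩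
  · simp [h.1, h'.1]
  · simp [h.2, h'.2, Function.comp_def]

/-- Apply a map to the tail of a word. -/
def liftTail (f : List ℕ → List ℕ) : List ℕ → List ℕ
  | [] => []
  | x :: t => x :: f t

/-- Apply a bijection to the tail of a word. -/
def liftPerm (φ : Equiv.Perm (List ℕ)) : Equiv.Perm (List ℕ) where
  toFun := liftTail φ
  invFun := liftTail φ.symm
  left_inv := by intro w; cases w <;> simp [liftTail]
  right_inv := by intro w; cases w <;> simp [liftTail]

theorem CEq.cons {u v : List ℕ} (x : ℕ) (h : CEq u v) : CEq (x :: u) (x :: v) := by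
  obtain ⟨φ, h, rfl⟩ := h
  refine ⟨liftPerm φ, ⟨fun i w => ?_, fun i w => ?_⟩, rfl⟩
  · cases w with
    | nil => rfl
    | cons y t => simp [liftPerm, liftTail, phS, h.1]
  · cases w with
    | nil => simp [liftPerm, liftTail, Fop_nil]
    | cons y t =>
      by_cases h0 : phS i t = 0
      · simp only [liftPerm, liftTail, Equiv.coe_fn_mk, Fop_cons, h.1, h.2, h0]
        rw [Fop_of_zero _ _ h0]
        split_ifs <;> simp_all [liftTail]
      · obtain ⟨t', ht'⟩ := Fop_some_of _ _ h0
        simp only [liftPerm, liftTail, Equiv.coe_fn_mk, Fop_cons, h.1, h.2, ht']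
        split_ifs <;> simp_all [liftTail]

/-- Knuth move on the first three letters. -/
def kap : List ℕ → List ℕ
  | a :: b :: c :: t =>
    if (c < a ∧ a ≤ b) ∨ (b < a ∧ a ≤ c) then a :: c :: b :: t
    else if (a ≤ c ∧ c < b) ∨ (b ≤ c ∧ c < a) then b :: a :: c :: t
    else a :: b :: c :: t
  | l => l

theorem kap_short (l : List ℕ) (h : l.length < 3) : kap l = l := by
  match l, h with
  | [], _ => rfl
  | [_], _ => rfl
  | [_, _], _ => rfl

theorem kap_kap (l : List ℕ) : kap (kap l) = l := by
  match l with
  | [] => rfl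
  | [_] => rfl
  | [_, _] => rfl
  | a :: b :: c :: t =>
    simp only [kap]
    split_ifs <;> simp only [kap] <;> split_ifs <;> first | rfl | omega

theorem kap_ph (i : ℕ) (l : List ℕ) : phS i (kap l) = phS i l := by
  match l with
  | [] => rfl
  | [_] => rfl
  | [_, _] => rfl
  | a :: b :: c :: t =>
    simp only [kap]
    split_ifs <;> simp only [phS] <;> split_ifs <;> omega

theorem kap_F (i : ℕ) (l : List ℕ) : Fop i (kap l) = (Fop i l).map kap := by
  by_cases hl : l.length < 3
  · rw [kap_short l hl]
    cases h : Fop i l with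
    | none => rfl
    | some l' =>
      have := Fop_length _ _ _ h
      simp [kap_short l' (by omega)]
  · match l with
    | [] => simp at hl
    | [_] => simp at hl
    | [_, _] => simp at hl
    | a :: b :: c :: t =>
      clear hl
      have hF : (phS i t = 0 ∧ Fop i t = none) ∨ (phS i t ≠ 0 ∧ ∃ t', Fop i t = some t') := by
        by_cases h : phS i t = 0
        · exact Or.inl ⟨h, Fop_of_zero _ _ h⟩
        · exact Or.inr ⟨h, Fop_some_of _ _ h⟩
      have ha : a = i ∨ a = i + 1 ∨ (a ≠ i ∧ a ≠ i + 1) := by omega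
      have hb : b = i ∨ b = i + 1 ∨ (b ≠ i ∧ b ≠ i + 1) := by omega
      have hc : c = i ∨ c = i + 1 ∨ (c ≠ i ∧ c ≠ i + 1) := by omega
      simp only [kap]
      rcases hF with ⟨h0, h1⟩ | ⟨h0, t', h1⟩ <;>
      rcases ha with rfl | rfl | ⟨ha, ha'⟩ <;> rcases hb with rfl | rfl | ⟨hb, hb'⟩ <;>
      rcases hc with rfl | rfl | ⟨hc, hc'⟩ <;>
      split_ifs <;> simp [Fop_cons, phS, *] <;> grind [kap]

/-- The Knuth move as a bijection. -/
def kapPerm : Equiv.Perm (List ℕ) := ⟨kap, kap, kap_kap, kap_kap⟩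

theorem CEq.knuth (x y z : ℕ) (t : List ℕ) (h1 : x ≤ y) (h2 : y < z) :
    CEq (x :: z :: y :: t) (z :: x :: y :: t) := by
  refine ⟨kapPerm, ⟨fun i w => kap_ph i w, fun i w => kap_F i w⟩, ?_⟩
  change kap (x :: z :: y :: t) = z :: x :: y :: t
  simp only [kap]
  split_ifs <;> first | rfl | omega

/-! ### Yamanouchi words -/

/-- Dominant content. -/
def Dom (l : List ℕ) : Prop := 0 ∉ l ∧ ∀ i, 1 ≤ i → l.count (i + 1) ≤ l.count i

/-- All suffixes have dominant content. -/
def Yam : List ℕ → Prop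
  | [] => True
  | x :: t => Yam t ∧ Dom (x :: t)

theorem Dom.perm {l l' : List ℕ} (h : Dom l) (p : l.Perm l') : Dom l' := by
  refine ⟨fun h0 => h.1 (p.mem_iff.2 h0), fun i hi => ?_⟩
  rw [← p.count_eq, ← p.count_eq]
  exact h.2 i hi

theorem Yam.dom {l : List ℕ} (h : Yam l) : Dom l := by
  cases l with
  | nil => exact ⟨by simp, by simp⟩
  | cons x t => exact h.2

theorem Dom.erase {l : List ℕ} (h : Dom l) (y : ℕ) (hy : l.count (y + 1) < l.count y) :
    Dom (l.erase y) := by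
  refine ⟨fun h0 => h.1 (List.mem_of_mem_erase h0), fun i hi => ?_⟩
  have := h.2 i hi
  rw [List.count_erase, List.count_erase]
  simp only [beq_iff_eq]
  by_cases hiy : y = i
  · subst hiy; simp; omega
  · rw [if_neg hiy]; omega

theorem exists_yam (n : ℕ) : ∀ l : List ℕ, l.length = n → Dom l → ∃ w, Yam w ∧ w.Perm l := by
  induction n with
  | zero =>
    intro l hl _
    rw [List.length_eq_zero_iff] at hl
    subst hl
    exact ⟨[], trivial, List.Perm.refl _⟩
  | succ n ih =>
    intro l hl hd
    have hne : l.toFinset.Nonempty := by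
      rw [List.toFinset_nonempty_iff]
      rintro rfl
      simp at hl
    obtain ⟨M, hM, hmax⟩ := l.toFinset.exists_max_image id hne
    rw [List.mem_toFinset] at hM
    have h0 : l.count (M + 1) = 0 := by
      rw [List.count_eq_zero]
      intro hc
      have := hmax (M + 1) (by simpa using hc)
      simp at this
    have h1 := List.count_pos_iff.2 hM
    obtain ⟨w, hw, hp⟩ := ih (l.erase M) (by rw [List.length_erase_of_mem hM]; omega)
      (hd.erase M (by omega))
    have hp2 : (M :: w).Perm l := (hp.cons M).trans (List.perm_cons_erase hM).symm
    exact ⟨M :: w, ⟨hw, hd.perm hp2.symm⟩, hp2⟩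

theorem exists_drop (f : ℕ → ℕ) (x k : ℕ) (h : f (x + k) < f x) :
    ∃ y, x ≤ y ∧ y < x + k ∧ f (y + 1) < f y := by
  induction k with
  | zero => simp at h
  | succ k ih =>
    by_cases h1 : f (x + k) < f x
    · obtain ⟨y, a, b, c⟩ := ih h1
      exact ⟨y, a, by omega, c⟩
    · exact ⟨x + k, by omega, by omega, by
        have : x + (k + 1) = x + k + 1 := rfl
        rw [this] at h; omega⟩

theorem dom_le {l : List ℕ} (h : Dom l) (x k : ℕ) (hx : 1 ≤ x) :
    l.count (x + k) ≤ l.count x := by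
  induction k with
  | zero => simp
  | succ k ih => exact (h.2 (x + k) (by omega)).trans ih

theorem yam_ceq (n : ℕ) : ∀ w w' : List ℕ, w.length = n → Yam w → Yam w' → w.Perm w' →
    CEq w w' := by
  induction n with
  | zero =>
    intro w w' hl _ _ hp
    rw [List.length_eq_zero_iff] at hl
    subst hl
    rw [List.nil_perm] at hp
    subst hp
    exact CEq.refl _
  | succ n ih =>
    have key : ∀ x x' t t', x < x' → (x :: t).length = n + 1 → Yam (x :: t) → Yam (x' :: t') →
        (x :: t).Perm (x' :: t') → CEq (x :: t) (x' :: t') := by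
      intro x x' t t' hxx hl hy hy' hp
      have hlt : t.length = n := by simpa using hl
      have hlt' : t'.length = n := by have := hp.length_eq; simp at this; omega
      have hx't : x' ∈ t := by
        have : x' ∈ x :: t := hp.mem_iff.2 (by simp)
        rcases List.mem_cons.1 this with h | h
        · omega
        · exact h
      have hx1 : 1 ≤ x := by
        rcases Nat.eq_zero_or_pos x with h | h
        · subst h; exact absurd (by simp) hy.2.1
        · exact h
      set l := t.erase x' with hldef
      have hpl : t.Perm (x' :: l) := List.perm_cons_erase hx't
      have hpl' : t'.Perm (x :: l) := by
        have h1 : (x' :: t').Perm (x' :: x :: l) :=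
          hp.symm.trans ((hpl.cons x).trans (List.Perm.swap _ _ _))
        exact h1.cons_inv
      have dt := hy.1.dom
      have dt' := hy'.1.dom
      have dw := hy.2
      have ct : ∀ j, t.count j = l.count j + if x' = j then 1 else 0 := by
        intro j; rw [hpl.count_eq, List.count_cons]; simp
      have ct' : ∀ j, t'.count j = l.count j + if x = j then 1 else 0 := by
        intro j; rw [hpl'.count_eq, List.count_cons]; simp
      have dl : Dom l := by
        apply dt.erase
        have h1 := dt'.2 x' (by omega)
        rw [ct', ct', if_neg (by omega), if_neg (by omega)] at h1
        rw [ct, ct, if_neg (by omega), if_pos rfl]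
        omega
      have hlt2 : l.count (x + (x' - x)) < l.count x := by
        have h1 := dom_le dt x (x' - x) hx1
        rw [ct, ct, if_pos (by omega), if_neg (by omega)] at h1
        omega
      obtain ⟨y, hy1, hy2, hy3⟩ := exists_drop (fun j => l.count j) x (x' - x) hlt2
      obtain ⟨s, hs, hsp⟩ := exists_yam _ (l.erase y) rfl (dl.erase y hy3)
      have hyl : y ∈ l := List.count_pos_iff.1 (by omega)
      have hp1 : (y :: s).Perm l := (hsp.cons y).trans (List.perm_cons_erase hyl).symm
      have Y1 : Yam (y :: s) := ⟨hs, dl.perm hp1.symm⟩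
      have q : t.Perm (x' :: y :: s) := hpl.trans (hp1.symm.cons x')
      have q' : t'.Perm (x :: y :: s) := hpl'.trans (hp1.symm.cons x)
      have e1 := ih t (x' :: y :: s) hlt hy.1 ⟨Y1, dt.perm q⟩ q
      have e2 := ih t' (x :: y :: s) hlt' hy'.1 ⟨Y1, dt'.perm q'⟩ q'
      exact ((e1.cons x).trans (CEq.knuth x y x' s hy1 (by omega))).trans (e2.cons x').symm
    intro w w' hl hy hy' hp
    match w, w' with
    | [], _ => simp at hl
    | x :: t, [] => simp at hp
    | x :: t, x' :: t' =>
      rcases lt_trichotomy x x' with h | h | h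
      · exact key _ _ _ _ h hl hy hy' hp
      · subst h
        exact (ih t t' (by simpa using hl) hy.1 hy'.1 hp.cons_inv).cons x
      · exact (key _ _ _ _ h (by rw [← hp.length_eq]; exact hl) hy' hy hp.symm).symm

/-! ### Highest words are Yamanouchi -/

theorem suffD_cons (i x : ℕ) (t : List ℕ) (k : ℕ) :
    suffD i (x :: t) (k + 1) = suffD i t k := by simp [suffD]

theorem open_shift (i x : ℕ) (t : List ℕ) (p : ℕ) (h : IsUnmatchedOpen i t p) :
    IsUnmatchedOpen i (x :: t) (p + 1) := by
  refine ⟨by simpa using h.1, ?_⟩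
  intro q hq hpq
  obtain ⟨q, rfl⟩ : ∃ r, q = r + 1 := ⟨q - 1, by omega⟩
  rw [suffD_cons, suffD_cons]
  exact h.2 q (by simpa using hq) (by omega)

theorem no_open_suff (i : ℕ) (w : List ℕ) (h : ∀ p, ¬ IsUnmatchedOpen i w p) :
    ∀ k, suffD i w k ≤ 0 := by
  induction w with
  | nil => simp [suffD]
  | cons x t ih =>
    have iht := ih (fun p hp => h _ (open_shift i x t p hp))
    intro k
    cases k with
    | succ k => rw [suffD_cons]; exact iht k
    | zero =>
      by_contra hc
      apply h 0
      refine ⟨?_, ?_⟩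
      · have h0 := iht 0
        simp only [suffD, List.drop_zero, List.count_cons, beq_iff_eq] at hc h0
        simp only [List.getElem?_cons_zero, Option.some.injEq]
        by_contra hx
        rw [if_neg hx] at hc
        split_ifs at hc <;> push_cast at hc <;> omega
      · intro q _ hq
        obtain ⟨q, rfl⟩ : ∃ r, q = r + 1 := ⟨q - 1, by omega⟩
        rw [suffD_cons]
        have := iht q
        omega

theorem no_open_of_E (i : ℕ) (w : List ℕ) (h : Eop i w = none) (p : ℕ) :
    ¬ IsUnmatchedOpen i w p := by
  intro hp
  have hm : p ∈ unmatchedOpens i w := by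
    simp only [unmatchedOpens, List.mem_filter, List.mem_range, decide_eq_true_eq]
    refine ⟨?_, hp⟩
    have := hp.1
    by_contra hc
    rw [List.getElem?_eq_none (by omega)] at this
    simp at this
  have hne := List.ne_nil_of_mem hm
  rw [Eop, List.head?_eq_some_head hne] at h
  simp at h

theorem yam_of_suff (w : List ℕ) (h0 : 0 ∉ w) (h : ∀ i, 1 ≤ i → ∀ k, suffD i w k ≤ 0) :
    Yam w := by
  induction w with
  | nil => trivial
  | cons x t ih =>
    refine ⟨ih (fun hc => h0 (by simp [hc])) (fun i hi k => ?_), h0, fun i hi => ?_⟩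
    · rw [← suffD_cons i x t k]; exact h i hi _
    · have := h i hi 0
      simp only [suffD, List.drop_zero] at this
      omega

theorem yam_of_high (m : ℕ) (v : List ℕ) (hv1 : IsWordOver m v)
    (hhv : ∀ i, 1 ≤ i → i < m → Eop i v = none) : Yam v := by
  apply yam_of_suff
  · intro h0
    have := (hv1 0 h0).1
    omega
  · intro i hi k
    by_cases him : i < m
    · exact no_open_suff i v (no_open_of_E i v (hhv i hi him)) k
    · have : (v.drop k).count (i + 1) = 0 := by
        rw [List.count_eq_zero]
        intro hc
        have := (hv1 _ (List.mem_of_mem_drop hc)).2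
        omega
      rw [suffD, this]
      simp

theorem IsAut.comp_map {φ : Equiv.Perm (List ℕ)} (h : IsAut φ) (m : ℕ) {v u : List ℕ}
    (hu : wordComp m v u) : wordComp m (φ v) (φ u) := by
  induction hu with
  | refl => exact Relation.ReflTransGen.refl
  | tail _ hb ih =>
    refine ih.tail ?_
    obtain ⟨i, h1, h2, h3⟩ := hb
    refine ⟨i, h1, h2, ?_⟩
    rcases h3 with h3 | h3
    · left; rw [h.2, h3]; rfl
    · right; rw [h.2, h3]; rfl

/-- Two connected components of the edge-colored crystal graph on `[m]^n`
whose highest-weight vertices `v`, `v'` have equal weights are isomorphic as edge-colored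
graphs; moreover the weight of a highest-weight vertex is weakly decreasing. -/
theorem highest_weight_component_iso (m n : ℕ) (hm : 1 ≤ m) (hn : 1 ≤ n)
    (v v' : List ℕ) (hv : v.length = n) (hv1 : IsWordOver m v)
    (hv' : v'.length = n) (hv1' : IsWordOver m v')
    (hhv : ∀ i, 1 ≤ i → i < m → Eop i v = none)
    (hhv' : ∀ i, 1 ≤ i → i < m → Eop i v' = none)
    (hwt : ∀ j, v.count j = v'.count j) :
    (∀ j, 1 ≤ j → v.count (j + 1) ≤ v.count j) ∧
    ∃ φ ψ : List ℕ → List ℕ,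
      (∀ u, wordComp m v u → wordComp m v' (φ u)) ∧
      (∀ u, wordComp m v' u → wordComp m v (ψ u)) ∧
      (∀ u, wordComp m v u → ψ (φ u) = u) ∧
      (∀ u, wordComp m v' u → φ (ψ u) = u) ∧
      (∀ u w, wordComp m v u → wordComp m v w → ∀ i, 1 ≤ i → i < m →
        (Fop i u = some w ↔ Fop i (φ u) = some (φ w))) := by
  have Y := yam_of_high m v hv1 hhv
  have Y' := yam_of_high m v' hv1' hhv'
  refine ⟨Y.dom.2, ?_⟩
  obtain ⟨φ, hφ, rfl⟩ := yam_ceq n v v' hv Y Y' (List.perm_iff_count.2 hwt)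
  refine ⟨φ, φ.symm, fun u hu => hφ.comp_map m hu, fun u hu => ?_, fun u _ => by simp,
    fun u _ => by simp, fun u w _ _ i _ _ => ?_⟩
  · have := hφ.symm.comp_map m hu
    simpa using this
  · rw [hφ.2]
    constructor
    · intro h; rw [h]; rfl
    · intro h
      rw [Option.map_eq_some_iff] at h
      obtain ⟨a, ha, hb⟩ := h
      rw [ha, φ.injective hb]
end

section
/- Fix a skew shape λ/μ, m ≥ 2, and i ∈ [m−1]. For every reverse plane partition T of shape λ/μ with entries in [m], F_i(r(T)) = r(f_i(T)); in particular f_i(T) = 0 if and only if F_i(r(T)) = 0, and when both are nonzero the reading word of f_i(T) equals F_i applied to the reading word of T. -/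
/-! ### Skew shapes and reverse plane partitions -/

/-- `(r, c)` is a cell of the skew shape `lam / mu` (matrix convention: `r` = row index
counted from the top, `c` = column index, both 0-based). -/
def IsSkewCell (lam mu : YoungDiagram) (r c : ℕ) : Prop :=
  (r, c) ∈ lam.cells ∧ (r, c) ∉ mu.cells

instance (lam mu : YoungDiagram) (r c : ℕ) : Decidable (IsSkewCell lam mu r c) := by
  unfold IsSkewCell; infer_instance

/-- `T` is a reverse plane partition of shape `lam / mu` with entries in `{1, …, m}`:
entries weakly increase along rows and columns; `T` is normalized to be `0` outside the
shape. -/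
def IsSkewRPP (lam mu : YoungDiagram) (m : ℕ) (T : ℕ → ℕ → ℕ) : Prop :=
  (∀ r c, ¬ IsSkewCell lam mu r c → T r c = 0) ∧
  (∀ r c, IsSkewCell lam mu r c → 1 ≤ T r c ∧ T r c ≤ m) ∧
  (∀ r c, IsSkewCell lam mu r c → IsSkewCell lam mu r (c + 1) → T r c ≤ T r (c + 1)) ∧
  (∀ r c, IsSkewCell lam mu r c → IsSkewCell lam mu (r + 1) c → T r c ≤ T (r + 1) c)

/-- The reading word of `T`: ignore each entry equal to the entry directly below it, and read
the remaining entries left-to-right, bottom-to-top. -/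
def readingWord (lam mu : YoungDiagram) (T : ℕ → ℕ → ℕ) : List ℕ :=
  ((List.range (lam.colLen 0)).reverse).flatMap fun r =>
    ((List.range (lam.rowLen r)).filter fun c =>
      decide (IsSkewCell lam mu r c) &&
        ! (decide (IsSkewCell lam mu (r + 1) c) && decide (T (r + 1) c = T r c))).map (T r)

/-- The height vector of `T`: the sequence of (1-based) row indices of the entries of `T`
contributing to the reading word, in reading order. -/
def heightWord (lam mu : YoungDiagram) (T : ℕ → ℕ → ℕ) : List ℕ :=
  ((List.range (lam.colLen 0)).reverse).flatMap fun r =>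
    ((List.range (lam.rowLen r)).filter fun c =>
      decide (IsSkewCell lam mu r c) &&
        ! (decide (IsSkewCell lam mu (r + 1) c) && decide (T (r + 1) c = T r c))).map
      fun _ => r + 1

/-! ### Columns, descents and descent-resolution -/

/-- Column `c` of the tableau `T` (of shape `lam/mu`) contains an entry equal to `v`. -/
def ColHasVal (lam mu : YoungDiagram) (T : ℕ → ℕ → ℕ) (c v : ℕ) : Prop :=
  ∃ r ∈ Finset.range (lam.colLen c), IsSkewCell lam mu r c ∧ T r c = v

instance (lam mu : YoungDiagram) (T : ℕ → ℕ → ℕ) (c v : ℕ) :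
    Decidable (ColHasVal lam mu T c v) := by
  unfold ColHasVal; infer_instance

/-- Column `c` is `i`-pure: it contains an `i` but no `i+1`. -/
def IsPureLow (i : ℕ) (lam mu : YoungDiagram) (T : ℕ → ℕ → ℕ) (c : ℕ) : Prop :=
  ColHasVal lam mu T c i ∧ ¬ ColHasVal lam mu T c (i + 1)

/-- Column `c` is `(i+1)`-pure: it contains an `i+1` but no `i`. -/
def IsPureHigh (i : ℕ) (lam mu : YoungDiagram) (T : ℕ → ℕ → ℕ) (c : ℕ) : Prop :=
  ColHasVal lam mu T c (i + 1) ∧ ¬ ColHasVal lam mu T c i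

/-- Column `c` is mixed: it contains both an `i` and an `i+1`. -/
def IsMixedCol (i : ℕ) (lam mu : YoungDiagram) (T : ℕ → ℕ → ℕ) (c : ℕ) : Prop :=
  ColHasVal lam mu T c i ∧ ColHasVal lam mu T c (i + 1)

instance (i : ℕ) (lam mu : YoungDiagram) (T : ℕ → ℕ → ℕ) (c : ℕ) :
    Decidable (IsPureLow i lam mu T c) := by unfold IsPureLow; infer_instance
instance (i : ℕ) (lam mu : YoungDiagram) (T : ℕ → ℕ → ℕ) (c : ℕ) :
    Decidable (IsPureHigh i lam mu T c) := by unfold IsPureHigh; infer_instance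

/-- The (0-based) row index of the lowest `i` in column `c`. -/
noncomputable def lowestLow (i : ℕ) (lam mu : YoungDiagram) (T : ℕ → ℕ → ℕ) (c : ℕ) : ℕ :=
  sSup {r | IsSkewCell lam mu r c ∧ T r c = i}

/-- A descent: the box `(r, c)` contains `i+1` and the box directly to its right contains
`i`. -/
def IsDescent (i : ℕ) (lam mu : YoungDiagram) (T : ℕ → ℕ → ℕ) (r c : ℕ) : Prop :=
  IsSkewCell lam mu r c ∧ IsSkewCell lam mu r (c + 1) ∧ T r c = i + 1 ∧ T r (c + 1) = i

/-- `T` has no descents (for the letters `i`, `i+1`). -/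
def NoDescent (i : ℕ) (lam mu : YoungDiagram) (T : ℕ → ℕ → ℕ) : Prop :=
  ∀ r c, ¬ IsDescent i lam mu T r c

/-- The value `v` is `i` or `i+1`. -/
def InBand (i v : ℕ) : Prop := v = i ∨ v = i + 1

/-- A benign tableau (for the letter `i`): it is `0` outside the shape, all its entries in the
shape are `i` or `i+1`, its entries weakly increase in columns, and for any two mixed columns
`a` (to the left) and `b` (to the right), the lowest `i` of `a` is not in a higher row than
the lowest `i` of `b`. -/
def IsBenign (i : ℕ) (lam mu : YoungDiagram) (T : ℕ → ℕ → ℕ) : Prop :=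
  (∀ r c, ¬ IsSkewCell lam mu r c → T r c = 0) ∧
  (∀ r c, IsSkewCell lam mu r c → T r c = i ∨ T r c = i + 1) ∧
  (∀ r c, IsSkewCell lam mu r c → IsSkewCell lam mu (r + 1) c → T r c ≤ T (r + 1) c) ∧
  (∀ a b, a < b → IsMixedCol i lam mu T a → IsMixedCol i lam mu T b →
    lowestLow i lam mu T a ≤ lowestLow i lam mu T b)

/-- A descent-resolution step at columns `c, c+1` changes no entry outside these two columns,
and no entry whose value is not `i` or `i+1`. -/
def StepFrame (i : ℕ) (lam mu : YoungDiagram) (T T' : ℕ → ℕ → ℕ) (c : ℕ) : Prop :=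
  ∀ r c', (¬ (c' = c ∨ c' = c + 1) ∨ ¬ (IsSkewCell lam mu r c' ∧ InBand i (T r c'))) →
    T' r c' = T r c'

/-- Descent-resolution step of type (2M): column `c` is `(i+1)`-pure, column `c+1` is mixed,
and there is a descent between them; column `c` becomes mixed with its lowest `i` in the same
row as the lowest `i` of column `c+1`, and column `c+1` becomes `(i+1)`-pure. -/
def Step2M (i : ℕ) (lam mu : YoungDiagram) (T T' : ℕ → ℕ → ℕ) (c : ℕ) : Prop :=
  IsPureHigh i lam mu T c ∧ IsMixedCol i lam mu T (c + 1) ∧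
  (∃ r, IsDescent i lam mu T r c) ∧ StepFrame i lam mu T T' c ∧
  (∀ r, IsSkewCell lam mu r c → InBand i (T r c) →
    T' r c = if r ≤ lowestLow i lam mu T (c + 1) then i else i + 1) ∧
  (∀ r, IsSkewCell lam mu r (c + 1) → InBand i (T r (c + 1)) → T' r (c + 1) = i + 1)

/-- Descent-resolution step of type (M1): column `c` is mixed, column `c+1` is `i`-pure,
and there is a descent between them; column `c` becomes `i`-pure, and column `c+1` becomes
mixed with its lowest `i` in the same row as the lowest `i` of column `c`. -/
def StepM1 (i : ℕ) (lam mu : YoungDiagram) (T T' : ℕ → ℕ → ℕ) (c : ℕ) : Prop :=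
  IsMixedCol i lam mu T c ∧ IsPureLow i lam mu T (c + 1) ∧
  (∃ r, IsDescent i lam mu T r c) ∧ StepFrame i lam mu T T' c ∧
  (∀ r, IsSkewCell lam mu r c → InBand i (T r c) → T' r c = i) ∧
  (∀ r, IsSkewCell lam mu r (c + 1) → InBand i (T r (c + 1)) →
    T' r (c + 1) = if r ≤ lowestLow i lam mu T c then i else i + 1)

/-- Descent-resolution step of type (21): column `c` is `(i+1)`-pure, column `c+1` is
`i`-pure, and there is a descent between them; all `i`'s are replaced by `(i+1)`'s and vice
versa in both columns. -/
def Step21 (i : ℕ) (lam mu : YoungDiagram) (T T' : ℕ → ℕ → ℕ) (c : ℕ) : Prop :=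
  IsPureHigh i lam mu T c ∧ IsPureLow i lam mu T (c + 1) ∧
  (∃ r, IsDescent i lam mu T r c) ∧ StepFrame i lam mu T T' c ∧
  (∀ r, IsSkewCell lam mu r c → InBand i (T r c) → T' r c = i) ∧
  (∀ r, IsSkewCell lam mu r (c + 1) → InBand i (T r (c + 1)) → T' r (c + 1) = i + 1)

/-- A descent-resolution step: a step of one of the three types, at some pair of adjacent
columns. -/
def DRStep (i : ℕ) (lam mu : YoungDiagram) (T T' : ℕ → ℕ → ℕ) : Prop :=
  ∃ c, Step2M i lam mu T T' c ∨ StepM1 i lam mu T T' c ∨ Step21 i lam mu T T' c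

/-! ### The crystal operators `f_i`, `e_i` on reverse plane partitions -/

/-- The list of pure columns (for the letters `i`, `i+1`), in left-to-right order. -/
def pureCols (i : ℕ) (lam mu : YoungDiagram) (T : ℕ → ℕ → ℕ) : List ℕ :=
  (List.range (lam.rowLen 0)).filter fun c =>
    decide (IsPureLow i lam mu T c) || decide (IsPureHigh i lam mu T c)

/-- The parenthesis word of the pure columns: each `i`-pure column contributes the letter `i`
(a closing parenthesis) and each `(i+1)`-pure column the letter `i+1` (an opening one). -/
def colWord (i : ℕ) (lam mu : YoungDiagram) (T : ℕ → ℕ → ℕ) : List ℕ :=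
  (pureCols i lam mu T).map fun c => if IsPureLow i lam mu T c then i else i + 1

/-- Replace all `i`'s by `(i+1)`'s in column `c`. -/
def raiseCol (i : ℕ) (lam mu : YoungDiagram) (T : ℕ → ℕ → ℕ) (c : ℕ) : ℕ → ℕ → ℕ :=
  fun r c' => if c' = c ∧ IsSkewCell lam mu r c' ∧ T r c' = i then i + 1 else T r c'

/-- Replace all `(i+1)`'s by `i`'s in column `c`. -/
def lowerCol (i : ℕ) (lam mu : YoungDiagram) (T : ℕ → ℕ → ℕ) (c : ℕ) : ℕ → ℕ → ℕ :=
  fun r c' => if c' = c ∧ IsSkewCell lam mu r c' ∧ T r c' = i + 1 then i else T r c'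

/-- `T' = f_i(T)`: the column `c` carrying the rightmost unmatched closing parenthesis (in the
parenthesation of the pure columns) has all its `i`'s replaced by `(i+1)`'s, and then the
descent-resolution algorithm is applied (i.e. descent-resolution steps are performed until no
descent remains, reaching `T'`). -/
def fiRel (i : ℕ) (lam mu : YoungDiagram) (T T' : ℕ → ℕ → ℕ) : Prop :=
  ∃ p c, (unmatchedCloses i (colWord i lam mu T)).getLast? = some p ∧
    (pureCols i lam mu T)[p]? = some c ∧
    Relation.ReflTransGen (DRStep i lam mu) (raiseCol i lam mu T c) T' ∧
    NoDescent i lam mu T'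

/-- `f_i(T) = 0`: every closing parenthesis (i.e. every `i`-pure column) is matched. -/
def fiZero (i : ℕ) (lam mu : YoungDiagram) (T : ℕ → ℕ → ℕ) : Prop :=
  unmatchedCloses i (colWord i lam mu T) = []

/-- `T' = e_i(T)`: the column `c` carrying the leftmost unmatched opening parenthesis (in the
parenthesation of the pure columns) has all its `(i+1)`'s replaced by `i`'s, and then the
descent-resolution algorithm is applied. -/
def eiRel (i : ℕ) (lam mu : YoungDiagram) (T T' : ℕ → ℕ → ℕ) : Prop :=
  ∃ p c, (unmatchedOpens i (colWord i lam mu T)).head? = some p ∧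
    (pureCols i lam mu T)[p]? = some c ∧
    Relation.ReflTransGen (DRStep i lam mu) (lowerCol i lam mu T c) T' ∧
    NoDescent i lam mu T'

/-- `e_i(T) = 0`: every opening parenthesis (i.e. every `(i+1)`-pure column) is matched. -/
def eiZero (i : ℕ) (lam mu : YoungDiagram) (T : ℕ → ℕ → ℕ) : Prop :=
  unmatchedOpens i (colWord i lam mu T) = []


/-! ## Helper lemmas -/

namespace FiAux

/-- Number of `i`'s minus number of `i+1`'s. -/
def dd (i : ℕ) (w : List ℕ) : ℤ := (w.count i : ℤ) - (w.count (i + 1) : ℤ)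

lemma takeInit (k : ℕ) (w : List ℕ) : w.take k <+: w := ⟨w.drop k, List.take_append_drop k w⟩

lemma dd_nil (i : ℕ) : dd i [] = 0 := by simp [dd]

lemma dd_append (i : ℕ) (a b : List ℕ) : dd i (a ++ b) = dd i a + dd i b := by
  simp only [dd, List.count_append]; push_cast; ring

lemma dd_le_count (i : ℕ) (a : List ℕ) : dd i a ≤ (a.count i : ℤ) := by
  unfold dd; omega

lemma dd_i (i : ℕ) : dd i [i] = 1 := by simp [dd]

lemma prefD_eq (i : ℕ) (w : List ℕ) (k : ℕ) : prefD i w k = dd i (w.take k) := rfl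

lemma prefD_zero (i : ℕ) (w : List ℕ) : prefD i w 0 = 0 := by simp [prefD]

lemma prefD_succ (i : ℕ) (w : List ℕ) (k : ℕ) :
    prefD i w (k + 1) ≤ prefD i w k + 1 ∧
    (prefD i w (k + 1) > prefD i w k → w[k]? = some i ∧ k < w.length) := by
  simp only [prefD_eq, List.take_add_one, dd_append]
  rcases h : w[k]? with _ | a
  · simp [dd_nil]
  · have hk : k < w.length := by
      by_contra hc
      rw [List.getElem?_eq_none (by omega)] at h; simp at h
    simp only [Option.toList_some]
    by_cases ha : a = i
    · subst ha; rw [dd_i]; exact ⟨le_refl _, fun _ => ⟨rfl, hk⟩⟩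
    · have : dd i [a] ≤ 0 := by
        have := dd_le_count i [a]
        rw [List.count_singleton] at this; simp [ha] at this; exact this
      constructor
      · omega
      · intro h; omega

/-- If `k` is the first position where `prefD` exceeds `B ≥ 0`, the previous letter is
unmatched. -/
lemma exists_unmatched (i : ℕ) (w : List ℕ) (B : ℤ) (hB : 0 ≤ B) (k : ℕ)
    (hk : B < prefD i w k) :
    ∃ p ∈ unmatchedCloses i w, B < prefD i w (p + 1) ∧ ∀ q ≤ p, prefD i w q ≤ B := by
  classical
  have hex : ∃ k, B < prefD i w k := ⟨k, hk⟩
  have hf := Nat.find_spec hex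
  have hmin := fun m => Nat.find_min (H := hex) (m := m)
  rcases hn : Nat.find hex with _ | p
  · rw [hn, prefD_zero] at hf; omega
  · rw [hn] at hf hmin
    have hle : ∀ q ≤ p, prefD i w q ≤ B := fun q hq => by
      have := hmin q (by omega); omega
    have h1 := (prefD_succ i w p).2 (by have := hle p le_rfl; omega)
    refine ⟨p, ?_, hf, hle⟩
    simp only [unmatchedCloses, List.mem_filter, List.mem_range, decide_eq_true_eq]
    exact ⟨h1.2, h1.1, fun q hq => by have := hle q hq; omega⟩

lemma unmatched_nil_iff (i : ℕ) (w : List ℕ) :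
    unmatchedCloses i w = [] ↔ ∀ k, prefD i w k ≤ 0 := by
  constructor
  · intro h k
    by_contra hc
    obtain ⟨p, hp, _⟩ := exists_unmatched i w 0 le_rfl k (by omega)
    rw [h] at hp; simp at hp
  · intro h
    rw [List.eq_nil_iff_forall_not_mem]
    intro p hp
    simp only [unmatchedCloses, List.mem_filter, List.mem_range, decide_eq_true_eq] at hp
    have h2 := hp.2.2 0 (by omega)
    rw [prefD_zero] at h2
    have := h (p + 1); omega

lemma range_filter_getLast (n : ℕ) (P : ℕ → Bool) (p : ℕ) :
    ((List.range n).filter P).getLast? = some p ↔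
      (p < n ∧ P p = true ∧ ∀ q, p < q → q < n → P q = false) := by
  induction n with
  | zero => simp
  | succ n ih =>
    rw [List.range_succ, List.filter_append]
    by_cases hn : P n = true
    · simp only [List.filter_cons, hn, if_true, List.filter_nil, List.getLast?_append,
        List.getLast?_singleton, Option.some_or, Option.some.injEq]
      constructor
      · rintro rfl
        exact ⟨by omega, hn, fun q h1 h2 => by omega⟩
      · rintro ⟨h1, h2, h3⟩
        by_contra hc
        have := h3 n (by omega) (by omega)
        simp [hn] at this
    · have hn' : P n = false := by simpa using hn
      simp only [List.filter_cons, hn', List.filter_nil]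
      simp only [Bool.false_eq_true, if_false, List.append_nil]
      rw [ih]
      constructor
      · rintro ⟨h1, h2, h3⟩
        refine ⟨by omega, h2, fun q hq hq2 => ?_⟩
        rcases Nat.lt_succ_iff_lt_or_eq.1 hq2 with h | rfl
        · exact h3 q hq h
        · exact hn'
      · rintro ⟨h1, h2, h3⟩
        refine ⟨?_, h2, fun q hq hq2 => h3 q hq (by omega)⟩
        rcases Nat.lt_succ_iff_lt_or_eq.1 h1 with h | rfl
        · exact h
        · simp [hn'] at h2

lemma last_unmatched_max (i : ℕ) (w : List ℕ) (p : ℕ)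
    (h : (unmatchedCloses i w).getLast? = some p) :
    p < w.length ∧ w[p]? = some i ∧ 1 ≤ prefD i w (p + 1) ∧
    (∀ q ≤ p, prefD i w q < prefD i w (p + 1)) ∧ ∀ q, prefD i w q ≤ prefD i w (p + 1) := by
  have h' := (range_filter_getLast _ _ _).1 h
  obtain ⟨h1, h2, h3⟩ := h'
  rw [decide_eq_true_eq] at h2
  have h0 : 1 ≤ prefD i w (p + 1) := by
    have := h2.2 0 (by omega); rw [prefD_zero] at this; omega
  refine ⟨h1, h2.1, h0, h2.2, fun q => ?_⟩
  by_contra hc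
  obtain ⟨p', hp', h4, h5⟩ :=
    exists_unmatched i w (prefD i w (p + 1)) (by omega) q (by omega)
  have hpp : p < p' := by
    by_contra hle
    rcases Nat.lt_or_ge p' p with hlt | hge
    · have := h2.2 (p' + 1) (by omega); omega
    · have : p' = p := by omega
      subst this; omega
  simp only [unmatchedCloses, List.mem_filter, List.mem_range] at hp'
  have := h3 p' hpp hp'.1
  rw [this] at hp'; simp at hp'

lemma Fop_split (i : ℕ) (A B : List ℕ)
    (hA : ∀ A', A' <+: A → dd i A' ≤ dd i A) (hB : ∀ B', B' <+: B → dd i B' ≤ 0) :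
    Fop i (A ++ i :: B) = some (A ++ (i + 1) :: B) := by
  have key : (unmatchedCloses i (A ++ i :: B)).getLast? = some A.length := by
    unfold unmatchedCloses
    rw [range_filter_getLast]
    have hp1 : prefD i (A ++ i :: B) (A.length + 1) = dd i A + 1 := by
      rw [prefD_eq, List.take_append]
      simp [List.take_of_length_le, dd_append, dd_i]
    refine ⟨by simp, ?_, ?_⟩
    · rw [decide_eq_true_eq]
      refine ⟨by simp, fun q hq => ?_⟩
      rw [hp1, prefD_eq, List.take_append_of_le_length hq]
      have := hA _ (takeInit q A); omega
    · intro q hq _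
      rw [decide_eq_false_iff_not]
      rintro ⟨_, h2⟩
      have h3 := h2 (A.length + 1) (by omega)
      rw [hp1, prefD_eq] at h3
      obtain ⟨k, rfl⟩ : ∃ k, q = A.length + k := ⟨q - A.length, by omega⟩
      rw [List.take_append, List.take_of_length_le (by omega)] at h3
      have : A.length + k + 1 - A.length = k + 1 := by omega
      rw [this, List.take_succ_cons, dd_append, ← List.singleton_append, dd_append, dd_i] at h3
      have := hB _ (takeInit k B); omega
  unfold Fop
  rw [key]
  simp

lemma prefix_append_split {A B C : List ℕ} (h : A <+: B ++ C) :
    A <+: B ∨ ∃ s, A = B ++ s ∧ s <+: C := by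
  rcases le_total A.length B.length with hl | hl
  · exact Or.inl (List.prefix_of_prefix_length_le h (List.prefix_append B C) hl)
  obtain ⟨s, rfl⟩ := List.prefix_of_prefix_length_le (List.prefix_append B C) h hl
  · exact Or.inr ⟨s, rfl, (List.prefix_append_right_inj B).1 h⟩

/-- Prefixes of a flatMap. -/
lemma prefix_flatMap_bound (i : ℕ) (f : ℕ → List ℕ) (ls : List ℕ) (A : List ℕ)
    (h : A <+: ls.flatMap f) :
    A = [] ∨ ∃ l1 r l2, ls = l1 ++ r :: l2 ∧
      dd i A ≤ dd i (l1.flatMap f) + ((f r).count i : ℤ) := by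
  induction ls generalizing A with
  | nil => left; simpa using h
  | cons r ls ih =>
    rw [List.flatMap_cons] at h
    rcases prefix_append_split h with h1 | ⟨s, rfl, hs⟩
    · right
      refine ⟨[], r, ls, rfl, ?_⟩
      simp only [List.flatMap_nil, dd_nil, zero_add]
      refine (dd_le_count i A).trans ?_
      exact_mod_cast h1.sublist.count_le i
    · rcases ih s hs with rfl | ⟨l1, r', l2, rfl, h2⟩
      · right
        refine ⟨[], r, ls, rfl, ?_⟩
        simp only [List.flatMap_nil, dd_nil, zero_add, List.append_nil]
        exact dd_le_count i _
      · right
        refine ⟨r :: l1, r', l2, rfl, ?_⟩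
        rw [dd_append, List.flatMap_cons, dd_append]; omega

lemma range_reverse_split (n : ℕ) (l1 l2 : List ℕ) (r : ℕ)
    (h : (List.range n).reverse = l1 ++ r :: l2) :
    r < n ∧ (∀ s, s ∈ l1 ↔ r < s ∧ s < n) ∧ l1.Nodup ∧ (∀ s, s ∈ l2 ↔ s < r) := by
  have hn : ((List.range n).reverse).Pairwise (· > ·) := by
    rw [List.pairwise_reverse]; exact List.pairwise_lt_range
  have hm : ∀ s, s ∈ l1 ++ r :: l2 ↔ s < n := fun s => by rw [← h]; simp
  rw [h] at hn
  rw [List.pairwise_append, List.pairwise_cons] at hn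
  obtain ⟨h1, ⟨h2, h3⟩, h4⟩ := hn
  refine ⟨(hm r).1 (by simp), fun s => ⟨fun hs => ⟨h4 s hs r (by simp), (hm s).1 (by simp [hs])⟩,
    fun ⟨hs1, hs2⟩ => ?_⟩, h1.imp (fun h => (ne_of_gt h)), fun s => ⟨fun hs => h2 s hs, fun hs => ?_⟩⟩
  · have := (hm s).2 hs2
    simp only [List.mem_append, List.mem_cons] at this
    rcases this with h | rfl | h
    · exact h
    · omega
    · have := h2 s h; omega
  · have hr : r < n := (hm r).1 (by simp)
    have := (hm s).2 (by omega)
    simp only [List.mem_append, List.mem_cons] at this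
    rcases this with h | rfl | h
    · have := h4 s h r (by simp); omega
    · omega
    · exact h

/-- Statistic of the rows `> r` plus the `i`'s of row `r`. -/
def Drow (i n : ℕ) (f : ℕ → List ℕ) (r : ℕ) : ℤ :=
  (∑ s ∈ Finset.Ico r n, ((f s).count i : ℤ)) -
    ∑ s ∈ Finset.Ico (r + 1) n, ((f s).count (i + 1) : ℤ)

lemma count_flatMap_sum (f : ℕ → List ℕ) (v : ℕ) (l : List ℕ) (hl : l.Nodup) :
    (((l.flatMap f).count v : ℕ) : ℤ) = ∑ s ∈ l.toFinset, ((f s).count v : ℤ) := by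
  induction l with
  | nil => simp
  | cons a l ih =>
    rw [List.nodup_cons] at hl
    rw [List.flatMap_cons, List.count_append, List.toFinset_cons, Finset.sum_insert (by simpa using hl.1)]
    push_cast
    rw [ih hl.2]

lemma Drow_split (i n : ℕ) (f : ℕ → List ℕ) (l1 l2 : List ℕ) (r : ℕ)
    (h : (List.range n).reverse = l1 ++ r :: l2) :
    dd i (l1.flatMap f) + ((f r).count i : ℤ) = Drow i n f r := by
  obtain ⟨h1, h2, h3, _⟩ := range_reverse_split n l1 l2 r h
  have hf : l1.toFinset = Finset.Ico (r + 1) n := by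
    ext s; simp [h2 s]; try omega
  unfold dd Drow
  rw [count_flatMap_sum f _ l1 h3, count_flatMap_sum f _ l1 h3, hf,
    Finset.sum_eq_sum_Ico_succ_bot h1]
  ring

lemma Fop_rows_none (i n : ℕ) (f : ℕ → List ℕ) (h : ∀ r < n, Drow i n f r ≤ 0) :
    Fop i ((List.range n).reverse.flatMap f) = none := by
  have : unmatchedCloses i ((List.range n).reverse.flatMap f) = [] := by
    rw [unmatched_nil_iff]
    intro k
    rw [prefD_eq]
    rcases prefix_flatMap_bound i f _ _ (takeInit k _) with h1 | ⟨l1, r, l2, h1, h2⟩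
    · rw [h1, dd_nil]
    · rw [Drow_split i n f l1 l2 r h1] at h2
      exact h2.trans (h r (range_reverse_split n l1 l2 r h1).1)
  unfold Fop; rw [this]; rfl

lemma Fop_rows_some (i n : ℕ) (f : ℕ → List ℕ) (r : ℕ) (hr : r < n) (M : ℤ) (hM : 1 ≤ M)
    (hD : Drow i n f r = M) (hlow : ∀ s, r < s → s < n → Drow i n f s ≤ M - 1)
    (hall : ∀ s < n, Drow i n f s ≤ M) (S1 S2 : List ℕ) (hf : f r = S1 ++ i :: S2)
    (h1 : i + 1 ∉ S1) (h2 : i ∉ S2) :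
    Fop i ((List.range n).reverse.flatMap f) =
      some ((List.range n).reverse.flatMap
        (fun s => if s = r then S1 ++ (i + 1) :: S2 else f s)) := by
  obtain ⟨l1, l2, hl⟩ := List.append_of_mem (show r ∈ (List.range n).reverse by simpa using hr)
  obtain ⟨_, hm1, hnd, hm2⟩ := range_reverse_split n l1 l2 r hl
  have hDs := Drow_split i n f l1 l2 r hl
  have hc : ((f r).count i : ℤ) = (S1.count i : ℤ) + 1 := by
    rw [hf, List.count_append, List.count_cons_self, List.count_eq_zero_of_not_mem h2]; push_cast; ring
  have hS1 : dd i S1 = (S1.count i : ℤ) := by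
    unfold dd; rw [List.count_eq_zero_of_not_mem h1]; simp
  have hA : dd i (l1.flatMap f ++ S1) = M - 1 := by
    rw [dd_append, hS1]; omega
  have e1 : (List.range n).reverse.flatMap f =
      (l1.flatMap f ++ S1) ++ i :: (S2 ++ l2.flatMap f) := by
    rw [hl, List.flatMap_append, List.flatMap_cons, hf]; simp
  have hg1 : l1.flatMap (fun s => if s = r then S1 ++ (i + 1) :: S2 else f s) = l1.flatMap f := by
    rw [List.flatMap_def, List.flatMap_def]; congr 1
    apply List.map_congr_left
    intro s hs
    have := (hm1 s).1 hs
    simp [show s ≠ r by omega]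
  have hg2 : l2.flatMap (fun s => if s = r then S1 ++ (i + 1) :: S2 else f s) = l2.flatMap f := by
    rw [List.flatMap_def, List.flatMap_def]; congr 1
    apply List.map_congr_left
    intro s hs
    have := (hm2 s).1 hs
    simp [show s ≠ r by omega]
  have e2 : (List.range n).reverse.flatMap
        (fun s => if s = r then S1 ++ (i + 1) :: S2 else f s) =
      (l1.flatMap f ++ S1) ++ (i + 1) :: (S2 ++ l2.flatMap f) := by
    rw [hl, List.flatMap_append, List.flatMap_cons, hg1, hg2]; simp
  rw [e1, e2]
  apply Fop_split
  · intro A' hA'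
    rw [hA]
    rcases prefix_append_split hA' with h | ⟨s, rfl, hs⟩
    · rcases prefix_flatMap_bound i f _ _ h with h | ⟨k1, s, k2, hk, hd⟩
      · rw [h, dd_nil]; omega
      · have hk' : (List.range n).reverse = k1 ++ s :: (k2 ++ r :: l2) := by
          rw [hl, hk]; simp
        rw [Drow_split i n f _ _ _ hk'] at hd
        have := (hm1 s).1 (by rw [hk]; simp)
        have := hlow s this.1 this.2
        omega
    · rw [dd_append] at hA ⊢
      have : dd i s ≤ dd i S1 := by
        rw [hS1]
        refine (dd_le_count i s).trans ?_
        exact_mod_cast hs.sublist.count_le i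
      omega
  · intro B' hB'
    have hpre : (l1.flatMap f ++ S1) ++ i :: B' <+: (List.range n).reverse.flatMap f := by
      rw [e1]
      obtain ⟨t, ht⟩ := hB'
      exact ⟨t, by rw [← ht]; simp⟩
    rcases prefix_flatMap_bound i f _ _ hpre with h | ⟨k1, s, k2, hk, hd⟩
    · simp at h
    · rw [Drow_split i n f _ _ _ hk] at hd
      have := hall s (range_reverse_split n _ _ _ hk).1
      rw [dd_append, hA, ← List.singleton_append, dd_append, dd_i] at hd
      omega

end FiAux

namespace FiAux

section Shape

variable {lam mu : YoungDiagram}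

lemma cell_convex {r c r' c' s d : ℕ} (h1 : IsSkewCell lam mu r c) (h2 : IsSkewCell lam mu r' c')
    (hs1 : r ≤ s) (hs2 : s ≤ r') (hd1 : c ≤ d) (hd2 : d ≤ c') : IsSkewCell lam mu s d := by
  refine ⟨?_, fun h => h1.2 ?_⟩
  · exact lam.up_left_mem hs2 hd2 h2.1
  · exact mu.up_left_mem hs1 hd1 h

lemma cell_row {r c : ℕ} (h : IsSkewCell lam mu r c) : r < lam.colLen 0 := by
  have := lam.up_left_mem (le_refl r) (Nat.zero_le c) h.1
  exact YoungDiagram.mem_iff_lt_colLen.1 this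

lemma cell_col {r c : ℕ} (h : IsSkewCell lam mu r c) : c < lam.rowLen 0 := by
  have := lam.up_left_mem (Nat.zero_le r) (le_refl c) h.1
  exact YoungDiagram.mem_iff_lt_rowLen.1 this

lemma cell_rowLen {r c : ℕ} (h : IsSkewCell lam mu r c) : c < lam.rowLen r :=
  YoungDiagram.mem_iff_lt_rowLen.1 h.1

lemma cell_colLen {r c : ℕ} (h : IsSkewCell lam mu r c) : r < lam.colLen c :=
  YoungDiagram.mem_iff_lt_colLen.1 h.1

lemma colHas_iff (T : ℕ → ℕ → ℕ) (c v : ℕ) :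
    ColHasVal lam mu T c v ↔ ∃ r, IsSkewCell lam mu r c ∧ T r c = v := by
  constructor
  · rintro ⟨r, _, h⟩; exact ⟨r, h⟩
  · rintro ⟨r, h⟩; exact ⟨r, by simpa using cell_colLen h.1, h⟩

lemma row_mono {S : ℕ → ℕ → ℕ} {r : ℕ}
    (h : ∀ c, IsSkewCell lam mu r c → IsSkewCell lam mu r (c + 1) → S r c ≤ S r (c + 1))
    {c c' : ℕ} (hc : IsSkewCell lam mu r c) (hc' : IsSkewCell lam mu r c') (hcc : c ≤ c') :
    S r c ≤ S r c' := by
  induction c', hcc using Nat.le_induction with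
  | base => exact le_rfl
  | succ d hd ih =>
    have hd' : IsSkewCell lam mu r d := cell_convex hc hc' le_rfl le_rfl hd (by omega)
    exact (ih hd').trans (h d hd' hc')

lemma col_mono {S : ℕ → ℕ → ℕ} {c : ℕ}
    (h : ∀ r, IsSkewCell lam mu r c → IsSkewCell lam mu (r + 1) c → S r c ≤ S (r + 1) c)
    {r r' : ℕ} (hc : IsSkewCell lam mu r c) (hc' : IsSkewCell lam mu r' c) (hcc : r ≤ r') :
    S r c ≤ S r' c := by
  induction r', hcc using Nat.le_induction with
  | base => exact le_rfl
  | succ d hd ih =>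
    have hd' : IsSkewCell lam mu d c := cell_convex hc hc' hd (by omega) le_rfl le_rfl
    exact (ih hd').trans (h d hd' hc')

/-- Monotonicity of a tableau in both directions. -/
def Mono (lam mu : YoungDiagram) (T : ℕ → ℕ → ℕ) : Prop :=
  ∀ r c r' c', IsSkewCell lam mu r c → IsSkewCell lam mu r' c' → r ≤ r' → c ≤ c' →
    T r c ≤ T r' c'

lemma mono_of_rpp {m : ℕ} {T : ℕ → ℕ → ℕ} (h : IsSkewRPP lam mu m T) : Mono lam mu T := by
  intro r c r' c' h1 h2 hr hc
  have h3 : IsSkewCell lam mu r c' := cell_convex h1 h2 le_rfl hr hc le_rfl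
  exact (row_mono (h.2.2.1 r) h1 h3 hc).trans (col_mono (fun r => h.2.2.2 r c') h3 h2 hr)

/-- The cell `(r,c)` contributes the letter `v` to the reading word. -/
def Contr (lam mu : YoungDiagram) (S : ℕ → ℕ → ℕ) (v r c : ℕ) : Prop :=
  IsSkewCell lam mu r c ∧ S r c = v ∧ ¬ (IsSkewCell lam mu (r + 1) c ∧ S (r + 1) c = v)

instance (S : ℕ → ℕ → ℕ) (v r c : ℕ) : Decidable (Contr lam mu S v r c) := by
  unfold Contr; infer_instance

/-- Number of letters `v` in row `r`. -/
def cnt (lam mu : YoungDiagram) (S : ℕ → ℕ → ℕ) (v r : ℕ) : ℕ :=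
  ((Finset.range (lam.rowLen 0)).filter fun c => Contr lam mu S v r c).card

/-- The reading word of row `r`. -/
def rowWord (lam mu : YoungDiagram) (S : ℕ → ℕ → ℕ) (r : ℕ) : List ℕ :=
  ((List.range (lam.rowLen r)).filter fun c =>
      decide (IsSkewCell lam mu r c) &&
        ! (decide (IsSkewCell lam mu (r + 1) c) && decide (S (r + 1) c = S r c))).map (S r)

lemma readingWord_eq (S : ℕ → ℕ → ℕ) :
    readingWord lam mu S = (List.range (lam.colLen 0)).reverse.flatMap (rowWord lam mu S) := rfl

lemma countP_range (n : ℕ) (p : ℕ → Prop) [DecidablePred p] :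
    (List.range n).countP (fun c => decide (p c)) = ((Finset.range n).filter p).card := by
  induction n with
  | zero => simp
  | succ n ih =>
    rw [List.range_succ, List.countP_append, ih, Finset.range_add_one, Finset.filter_insert]
    by_cases h : p n
    · simp [h]
    · simp [h]

lemma count_rowWord (S : ℕ → ℕ → ℕ) (v r : ℕ) :
    (rowWord lam mu S r).count v = cnt lam mu S v r := by
  unfold rowWord cnt
  rw [List.count, List.countP_map, List.countP_filter]
  have : ∀ c, (((fun x => x == v) ∘ S r) c && (decide (IsSkewCell lam mu r c) &&
        ! (decide (IsSkewCell lam mu (r + 1) c) && decide (S (r + 1) c = S r c)))) =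
      decide (Contr lam mu S v r c) := by
    intro c
    rw [Bool.eq_iff_iff, decide_eq_true_eq (p := Contr lam mu S v r c)]
    simp only [Contr, Function.comp, Bool.and_eq_true, beq_iff_eq, decide_eq_true_eq,
      Bool.not_eq_true', Bool.and_eq_false_iff, decide_eq_false_iff_not]
    constructor
    · rintro ⟨h1, h2, h3⟩
      exact ⟨h2, h1, by rw [← h1]; tauto⟩
    · rintro ⟨h1, h2, h3⟩
      refine ⟨h2, h1, ?_⟩
      rw [h2]; tauto
  simp only [this]
  rw [countP_range]
  congr 1
  ext c
  simp only [Finset.mem_filter, Finset.mem_range]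
  constructor
  · rintro ⟨_, h⟩; exact ⟨cell_col h.1, h⟩
  · rintro ⟨_, h⟩; exact ⟨cell_rowLen h.1, h⟩

lemma sorted_rowWord {S : ℕ → ℕ → ℕ} {r : ℕ}
    (h : ∀ c, IsSkewCell lam mu r c → IsSkewCell lam mu r (c + 1) → S r c ≤ S r (c + 1)) :
    (rowWord lam mu S r).Pairwise (· ≤ ·) := by
  unfold rowWord
  rw [List.pairwise_map, List.pairwise_filter]
  refine List.pairwise_lt_range.imp ?_
  intro a b hab ha hb
  simp only [Bool.and_eq_true, decide_eq_true_eq] at ha hb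
  exact row_mono h ha.1 hb.1 hab.le

lemma contr_unique {T : ℕ → ℕ → ℕ} (hT : Mono lam mu T) {v r r' c : ℕ}
    (h : Contr lam mu T v r c) (h' : Contr lam mu T v r' c) : r = r' := by
  have key : ∀ r r', Contr lam mu T v r c → Contr lam mu T v r' c → ¬ r < r' := by
    intro r r' h h' hlt
    have hc : IsSkewCell lam mu (r + 1) c := cell_convex h.1 h'.1 (by omega) hlt le_rfl le_rfl
    have h1 := hT _ _ _ _ h.1 hc (by omega) le_rfl
    have h2 := hT _ _ _ _ hc h'.1 hlt le_rfl
    have := h.2.1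
    have := h'.2.1
    exact h.2.2 ⟨hc, by omega⟩
  have := key r r' h h'
  have := key r' r h' h
  omega

lemma exists_contr (T : ℕ → ℕ → ℕ) {v r c : ℕ} (h : IsSkewCell lam mu r c) (hv : T r c = v) :
    ∃ s, r ≤ s ∧ Contr lam mu T v s c := by
  by_contra hcon
  push Not at hcon
  have key : ∀ k, IsSkewCell lam mu (r + k) c ∧ T (r + k) c = v := by
    intro k
    induction k with
    | zero => exact ⟨h, hv⟩
    | succ k ih =>
      by_contra hc
      exact hcon (r + k) (by omega) ⟨ih.1, ih.2, hc⟩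
  have := cell_colLen (key (lam.colLen c)).1
  omega

/-- After a contributing `v`, lower cells are larger. -/
lemma contr_below {T : ℕ → ℕ → ℕ} (hT : Mono lam mu T) {v r s c : ℕ}
    (h : Contr lam mu T v r c) (hs : IsSkewCell lam mu s c) (hrs : r < s) : v < T s c := by
  have hc : IsSkewCell lam mu (r + 1) c := cell_convex h.1 hs (by omega) hrs le_rfl le_rfl
  have h1 := hT _ _ _ _ h.1 hc (by omega) le_rfl
  have h2 := hT _ _ _ _ hc hs hrs le_rfl
  have h3 : T (r + 1) c ≠ v := fun e => h.2.2 ⟨hc, e⟩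
  have := h.2.1
  omega

lemma sum_cnt {T : ℕ → ℕ → ℕ} (hT : Mono lam mu T) (v a : ℕ) :
    (∑ s ∈ Finset.Ico a (lam.colLen 0), ((rowWord lam mu T s).count v : ℤ)) =
      (((Finset.range (lam.rowLen 0)).filter
        fun c => ∃ s ∈ Finset.Ico a (lam.colLen 0), Contr lam mu T v s c).card : ℤ) := by
  simp only [count_rowWord, cnt]
  rw [← Nat.cast_sum, ← Finset.card_biUnion]
  · congr 2
    ext c
    simp only [Finset.mem_biUnion, Finset.mem_filter]
    tauto
  · intro s _ s' _ hne
    rw [Function.onFun, Finset.disjoint_left]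
    intro c hc hc'
    simp only [Finset.mem_filter] at hc hc'
    exact hne (contr_unique hT hc.2 hc'.2)

/-- Column statistic: number of low pure columns minus number of high pure ones among the
first `x`. -/
def dcol (i : ℕ) (lam mu : YoungDiagram) (T : ℕ → ℕ → ℕ) (x : ℕ) : ℤ :=
  (((Finset.range x).filter fun c => IsPureLow i lam mu T c).card : ℤ) -
    (((Finset.range x).filter fun c => IsPureHigh i lam mu T c).card : ℤ)

lemma dcol_succ (i : ℕ) (T : ℕ → ℕ → ℕ) (x : ℕ) :
    dcol i lam mu T (x + 1) = dcol i lam mu T x +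
      (if IsPureLow i lam mu T x then 1 else 0) - (if IsPureHigh i lam mu T x then 1 else 0) := by
  unfold dcol
  rw [Finset.range_add_one, Finset.filter_insert, Finset.filter_insert]
  split_ifs <;> simp <;> ring

lemma Drow_le {T : ℕ → ℕ → ℕ} (hT : Mono lam mu T) (i r q : ℕ)
    (h1 : ∀ c s, r ≤ s → IsSkewCell lam mu s c → T s c = i → c < q)
    (h2 : ∀ c < q, ∃ c0 s, c ≤ c0 ∧ r ≤ s ∧ IsSkewCell lam mu s c0 ∧ T s c0 = i) :
    Drow i (lam.colLen 0) (rowWord lam mu T) r ≤ dcol i lam mu T q := by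
  unfold Drow dcol
  rw [sum_cnt hT, sum_cnt hT]
  set X := (Finset.range (lam.rowLen 0)).filter
        fun c => ∃ s ∈ Finset.Ico r (lam.colLen 0), Contr lam mu T i s c with hX
  set Y := (Finset.range (lam.rowLen 0)).filter
        fun c => ∃ s ∈ Finset.Ico (r + 1) (lam.colLen 0), Contr lam mu T (i + 1) s c with hY
  set L := (Finset.range q).filter fun c => IsPureLow i lam mu T c with hL
  set H := (Finset.range q).filter fun c => IsPureHigh i lam mu T c with hH
  have hd : Disjoint X H := by
    rw [Finset.disjoint_left]
    intro c hc hc'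
    simp only [hX, hH, Finset.mem_filter] at hc hc'
    obtain ⟨_, s, _, hs⟩ := hc
    exact hc'.2.2 ((colHas_iff T c i).2 ⟨s, hs.1, hs.2.1⟩)
  have hsub : X ∪ H ⊆ L ∪ Y := by
    intro c hc
    rw [Finset.mem_union] at hc ⊢
    rcases hc with hc | hc
    · simp only [hX, Finset.mem_filter, Finset.mem_Ico, Finset.mem_range] at hc
      obtain ⟨hcN, s, hs, hcs⟩ := hc
      by_cases hi1 : ColHasVal lam mu T c (i + 1)
      · right
        obtain ⟨t, ht, htv⟩ := (colHas_iff T c (i + 1)).1 hi1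
        obtain ⟨t', htt, ht'⟩ := exists_contr T ht htv
        simp only [hY, Finset.mem_filter, Finset.mem_Ico, Finset.mem_range]
        refine ⟨hcN, t', ⟨?_, cell_row ht'.1⟩, ht'⟩
        by_contra hlt
        have := hT _ _ _ _ ht'.1 hcs.1 (by omega) le_rfl
        have := ht'.2.1
        have := hcs.2.1
        omega
      · left
        simp only [hL, Finset.mem_filter, Finset.mem_range]
        exact ⟨h1 c s hs.1 hcs.1 hcs.2.1, (colHas_iff T c i).2 ⟨s, hcs.1, hcs.2.1⟩, hi1⟩
    · right
      simp only [hH, Finset.mem_filter, Finset.mem_range] at hc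
      obtain ⟨hcq, hc1, _⟩ := hc
      obtain ⟨t, ht, htv⟩ := (colHas_iff T c (i + 1)).1 hc1
      obtain ⟨t', htt, ht'⟩ := exists_contr T ht htv
      obtain ⟨c0, s, hc0, hs, hcell, hv⟩ := h2 c hcq
      simp only [hY, Finset.mem_filter, Finset.mem_Ico, Finset.mem_range]
      refine ⟨cell_col ht, t', ⟨?_, cell_row ht'.1⟩, ht'⟩
      by_contra hlt
      have := hT _ _ _ _ ht'.1 hcell (by omega) hc0
      have := ht'.2.1
      omega
  have e1 := Finset.card_union_of_disjoint hd
  have e2 := Finset.card_le_card hsub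
  have e3 := Finset.card_union_le L Y
  omega

/-- The bound above for a suitable `q`. -/
lemma Drow_le_exists {T : ℕ → ℕ → ℕ} (hT : Mono lam mu T) (i r : ℕ) :
    ∃ q, Drow i (lam.colLen 0) (rowWord lam mu T) r ≤ dcol i lam mu T q ∧
      (∀ B, (∀ c s, r ≤ s → IsSkewCell lam mu s c → T s c = i → c < B) → q ≤ B) := by
  classical
  have hex : ∃ q, ∀ c s, r ≤ s → IsSkewCell lam mu s c → T s c = i → c < q :=
    ⟨lam.rowLen 0, fun c s _ h _ => cell_col h⟩
  refine ⟨Nat.find hex, ?_, fun B hB => Nat.find_min' hex hB⟩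
  apply Drow_le hT i r _ (Nat.find_spec hex)
  intro c hc
  have := Nat.find_min hex hc
  push Not at this
  obtain ⟨c0, s, h1, h2, h3, h4⟩ := this
  exact ⟨c0, s, h4, h1, h2, h3⟩

lemma Drow_ge {T : ℕ → ℕ → ℕ} (hT : Mono lam mu T) (i r c0 : ℕ)
    (hp : IsPureLow i lam mu T c0) (hr : Contr lam mu T i r c0) :
    dcol i lam mu T (c0 + 1) ≤ Drow i (lam.colLen 0) (rowWord lam mu T) r := by
  unfold Drow dcol
  rw [sum_cnt hT, sum_cnt hT]
  set X := (Finset.range (lam.rowLen 0)).filter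
        fun c => ∃ s ∈ Finset.Ico r (lam.colLen 0), Contr lam mu T i s c with hX
  set Y := (Finset.range (lam.rowLen 0)).filter
        fun c => ∃ s ∈ Finset.Ico (r + 1) (lam.colLen 0), Contr lam mu T (i + 1) s c with hY
  set L := (Finset.range (c0 + 1)).filter fun c => IsPureLow i lam mu T c with hL
  set H := (Finset.range (c0 + 1)).filter fun c => IsPureHigh i lam mu T c with hH
  have hd : Disjoint L Y := by
    rw [Finset.disjoint_left]
    intro c hc hc'
    simp only [hL, hY, Finset.mem_filter] at hc hc'
    obtain ⟨_, s, _, hs⟩ := hc'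
    exact hc.2.2 ((colHas_iff T c (i + 1)).2 ⟨s, hs.1, hs.2.1⟩)
  have inX : ∀ c ≤ c0, ColHasVal lam mu T c i → c ∈ X := by
    intro c hc hcv
    obtain ⟨t, ht, htv⟩ := (colHas_iff T c i).1 hcv
    obtain ⟨s, _, hs⟩ := exists_contr T ht htv
    simp only [hX, Finset.mem_filter, Finset.mem_Ico, Finset.mem_range]
    refine ⟨cell_col ht, s, ⟨?_, cell_row hs.1⟩, hs⟩
    by_contra hlt
    have hcell : IsSkewCell lam mu (s + 1) c :=
      cell_convex hs.1 hr.1 (by omega) (by omega) le_rfl hc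
    have h1 := contr_below hT hs hcell (by omega)
    have h2 := hT _ _ _ _ hcell hr.1 (by omega) hc
    have := hr.2.1
    omega
  have hsub : L ∪ Y ⊆ X ∪ H := by
    intro c hc
    rw [Finset.mem_union] at hc ⊢
    rcases hc with hc | hc
    · left
      simp only [hL, Finset.mem_filter, Finset.mem_range] at hc
      exact inX c (by omega) hc.2.1
    · simp only [hY, Finset.mem_filter, Finset.mem_Ico, Finset.mem_range] at hc
      obtain ⟨hcN, s, hs, hcs⟩ := hc
      have hle : c ≤ c0 := by
        by_contra hlt
        have hcell : IsSkewCell lam mu (r + 1) c0 :=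
          cell_convex hr.1 hcs.1 (by omega) (by omega) le_rfl (by omega)
        have h1 := contr_below hT hr hcell (by omega)
        have h2 := hT _ _ _ _ hcell hcs.1 (by omega) (by omega)
        have := hcs.2.1
        exact hp.2 ((colHas_iff T c0 (i + 1)).2 ⟨r + 1, hcell, by omega⟩)
      by_cases hi1 : ColHasVal lam mu T c i
      · left; exact inX c hle hi1
      · right
        simp only [hH, Finset.mem_filter, Finset.mem_range]
        exact ⟨by omega, (colHas_iff T c (i + 1)).2 ⟨s, hcs.1, hcs.2.1⟩, hi1⟩
  have e1 := Finset.card_union_of_disjoint hd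
  have e2 := Finset.card_le_card hsub
  have e3 := Finset.card_union_le X H
  omega

lemma Drow_lt {T : ℕ → ℕ → ℕ} (hT : Mono lam mu T) (i r c0 : ℕ)
    (hr : Contr lam mu T i r c0) (M : ℤ) (hM : ∀ q ≤ c0, dcol i lam mu T q ≤ M)
    (s : ℕ) (hs : r < s) : Drow i (lam.colLen 0) (rowWord lam mu T) s ≤ M := by
  obtain ⟨q, hq, hq2⟩ := Drow_le_exists hT i s
  refine hq.trans (hM q (hq2 c0 ?_))
  intro c t hst hcell hv
  by_contra hlt
  have hcell' : IsSkewCell lam mu (r + 1) c0 :=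
    cell_convex hr.1 hcell (by omega) (by omega) le_rfl (by omega)
  have h1 := contr_below hT hr hcell' (by omega)
  have h2 := hT _ _ _ _ hcell' hcell (by omega) (by omega)
  omega

/-! ### The column word -/

lemma low_col_lt {T : ℕ → ℕ → ℕ} {c v : ℕ} (h : ColHasVal lam mu T c v) :
    c < lam.rowLen 0 := by
  obtain ⟨r, hr, _⟩ := (colHas_iff T c v).1 h
  exact cell_col hr

/-- The pure columns among the first `x` ones. -/
def pc (i : ℕ) (lam mu : YoungDiagram) (T : ℕ → ℕ → ℕ) (x : ℕ) : List ℕ :=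
  (List.range x).filter fun c =>
    decide (IsPureLow i lam mu T c) || decide (IsPureHigh i lam mu T c)

lemma pc_succ (i : ℕ) (T : ℕ → ℕ → ℕ) (x : ℕ) : pc i lam mu T (x + 1) = pc i lam mu T x ++
    (if IsPureLow i lam mu T x ∨ IsPureHigh i lam mu T x then [x] else []) := by
  unfold pc
  rw [List.range_succ, List.filter_append]
  congr 1
  by_cases h : IsPureLow i lam mu T x ∨ IsPureHigh i lam mu T x
  · simp [h]
  · simp [h]

lemma dd_pc (i : ℕ) (T : ℕ → ℕ → ℕ) (x : ℕ) :
    dd i ((pc i lam mu T x).map fun c => if IsPureLow i lam mu T c then i else i + 1) =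
      dcol i lam mu T x := by
  induction x with
  | zero => simp [pc, dcol, dd]
  | succ x ih =>
    rw [pc_succ, List.map_append, dd_append, ih, dcol_succ]
    by_cases h1 : IsPureLow i lam mu T x
    · have h2 : ¬ IsPureHigh i lam mu T x := fun h => h.2 h1.1
      simp [h1, h2, dd]
    · by_cases h2 : IsPureHigh i lam mu T x
      · simp [h1, h2, dd]; ring
      · simp [h1, h2, dd]

lemma pcInit (i : ℕ) (T : ℕ → ℕ → ℕ) {x y : ℕ} (h : x ≤ y) :
    pc i lam mu T x <+: pc i lam mu T y := by
  induction y, h using Nat.le_induction with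
  | base => exact List.prefix_rfl
  | succ y _ ih => exact ih.trans (by rw [pc_succ]; exact List.prefix_append _ _)

lemma pc_ge (i : ℕ) (T : ℕ → ℕ → ℕ) {x : ℕ} (h : lam.rowLen 0 ≤ x) :
    pc i lam mu T x = pureCols i lam mu T := by
  induction x, h using Nat.le_induction with
  | base => rfl
  | succ y hy ih =>
    rw [pc_succ, ih]
    have h1 : ¬ IsPureLow i lam mu T y := fun h => by
      have := low_col_lt h.1; omega
    have h2 : ¬ IsPureHigh i lam mu T y := fun h => by
      have := low_col_lt h.1; omega
    simp [h1, h2]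

lemma pcAllInit (i : ℕ) (T : ℕ → ℕ → ℕ) (x : ℕ) :
    pc i lam mu T x <+: pureCols i lam mu T := by
  rw [← pc_ge i T (le_max_left (lam.rowLen 0) x)]
  exact pcInit i T (le_max_right _ _)

lemma prefD_colWord (i : ℕ) (T : ℕ → ℕ → ℕ) (x : ℕ) :
    prefD i (colWord i lam mu T) (pc i lam mu T x).length = dcol i lam mu T x := by
  rw [prefD_eq, colWord, ← List.map_take, ← List.prefix_iff_eq_take.1 (pcAllInit i T x), dd_pc]

lemma pureCols_index (i : ℕ) (T : ℕ → ℕ → ℕ) {p c : ℕ}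
    (h : (pureCols i lam mu T)[p]? = some c) :
    (IsPureLow i lam mu T c ∨ IsPureHigh i lam mu T c) ∧ (pc i lam mu T c).length = p ∧
      (pc i lam mu T (c + 1)).length = p + 1 := by
  have hmem := List.mem_of_getElem? h
  have hc : IsPureLow i lam mu T c ∨ IsPureHigh i lam mu T c := by
    simpa using (List.mem_filter.1 hmem).2
  have e := pc_succ (lam := lam) (mu := mu) i T c
  rw [if_pos hc] at e
  have hlen : (pc i lam mu T (c + 1)).length = (pc i lam mu T c).length + 1 := by rw [e]; simp
  have hnd : (pureCols i lam mu T).Nodup := List.Nodup.filter _ List.nodup_range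
  have hget : (pureCols i lam mu T)[(pc i lam mu T c).length]? = some c := by
    obtain ⟨t, ht⟩ := pcAllInit i T (c + 1)
    rw [← ht, e]; simp
  have hp : (pc i lam mu T c).length = p := by
    have hlt : p < (pureCols i lam mu T).length := (List.getElem?_eq_some_iff.1 h).1
    exact ((List.getElem?_inj hlt hnd).1 (h.trans hget.symm)).symm
  exact ⟨hc, hp, by omega⟩

end Shape
end FiAux

namespace FiAux

section Steps

variable {lam mu : YoungDiagram}

lemma inBand_iff (i v : ℕ) : InBand i v ↔ v = i ∨ v = i + 1 := Iff.rfl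

/-- The invariant satisfied by all tableaux met by the descent-resolution algorithm:
the only descents are between columns `e` and `e+1`, and column `e` is `(i+1)`-pure. -/
structure Inv (i : ℕ) (lam mu : YoungDiagram) (T S0 S : ℕ → ℕ → ℕ) (M : ℤ) (e : ℕ) : Prop where
  band : ∀ r c, IsSkewCell lam mu r c → (InBand i (S r c) ↔ InBand i (T r c))
  nonband : ∀ r c, IsSkewCell lam mu r c → ¬ InBand i (T r c) → S r c = T r c
  right : ∀ r c, e < c → S r c = T r c
  high : ∀ r, IsSkewCell lam mu r e → InBand i (T r e) → S r e = i + 1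
  rows : ∀ r c, c ≠ e → IsSkewCell lam mu r c → IsSkewCell lam mu r (c + 1) →
    S r c ≤ S r (c + 1)
  prevT : ∀ r c, c + 1 = e → IsSkewCell lam mu r c → IsSkewCell lam mu r e → S r c ≤ T r e
  counts : ∀ v r, cnt lam mu S v r = cnt lam mu S0 v r
  dval : dcol i lam mu T (e + 1) = M

lemma contr_nonband {i : ℕ} {T S : ℕ → ℕ → ℕ}
    (band : ∀ r c, IsSkewCell lam mu r c → (InBand i (S r c) ↔ InBand i (T r c)))
    (nonband : ∀ r c, IsSkewCell lam mu r c → ¬ InBand i (T r c) → S r c = T r c)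
    {v : ℕ} (hv : ¬ InBand i v) (r c : ℕ) : Contr lam mu S v r c ↔ Contr lam mu T v r c := by
  have key : ∀ r c, IsSkewCell lam mu r c → (S r c = v ↔ T r c = v) := by
    intro r c h
    by_cases hb : InBand i (T r c)
    · have := (band r c h).2 hb
      constructor
      · intro e; rw [e] at this; exact absurd this hv
      · intro e; rw [e] at hb; exact absurd hb hv
    · rw [nonband r c h hb]
  unfold Contr
  constructor
  · rintro ⟨h1, h2, h3⟩
    exact ⟨h1, (key r c h1).1 h2, fun h => h3 ⟨h.1, (key _ _ h.1).2 h.2⟩⟩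
  · rintro ⟨h1, h2, h3⟩
    exact ⟨h1, (key r c h1).2 h2, fun h => h3 ⟨h.1, (key _ _ h.1).1 h.2⟩⟩

lemma lowestLow_spec (i : ℕ) (T : ℕ → ℕ → ℕ) (c : ℕ) (h : ColHasVal lam mu T c i) :
    (IsSkewCell lam mu (lowestLow i lam mu T c) c ∧ T (lowestLow i lam mu T c) c = i) ∧
    ∀ r, IsSkewCell lam mu r c → T r c = i → r ≤ lowestLow i lam mu T c := by
  obtain ⟨r, hr⟩ := (colHas_iff T c i).1 h
  have hb : BddAbove {r | IsSkewCell lam mu r c ∧ T r c = i} :=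
    ⟨lam.colLen c, fun s hs => (cell_colLen hs.1).le⟩
  exact ⟨Nat.sSup_mem (s := {r | IsSkewCell lam mu r c ∧ T r c = i}) ⟨r, hr⟩ hb,
    fun s h1 h2 => le_csSup hb ⟨h1, h2⟩⟩

/-- Core of the step: counts are preserved. -/
lemma step_counts {i : ℕ} {T S S' : ℕ → ℕ → ℕ} {e x : ℕ} (hT : Mono lam mu T)
    (band : ∀ r c, IsSkewCell lam mu r c → (InBand i (S r c) ↔ InBand i (T r c)))
    (nonband : ∀ r c, IsSkewCell lam mu r c → ¬ InBand i (T r c) → S r c = T r c)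
    (right : ∀ r c, e < c → S r c = T r c)
    (high : ∀ r, IsSkewCell lam mu r e → InBand i (T r e) → S r e = i + 1)
    (band' : ∀ r c, IsSkewCell lam mu r c → (InBand i (S' r c) ↔ InBand i (T r c)))
    (nonband' : ∀ r c, IsSkewCell lam mu r c → ¬ InBand i (T r c) → S' r c = T r c)
    (hout : ∀ r c, c ≠ e → c ≠ e + 1 → S' r c = S r c)
    (he : ∀ r, IsSkewCell lam mu r e → InBand i (T r e) → S' r e = if r ≤ x then i else i + 1)
    (he1 : ∀ r, IsSkewCell lam mu r (e + 1) → InBand i (T r (e + 1)) → S' r (e + 1) = i + 1)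
    (hx : IsSkewCell lam mu x (e + 1)) (hxv : T x (e + 1) = i)
    (hxmax : ∀ r, IsSkewCell lam mu r (e + 1) → T r (e + 1) = i → r ≤ x)
    (y : ℕ) (hy : IsSkewCell lam mu y (e + 1)) (hyv : T y (e + 1) = i + 1)
    (t : ℕ) (ht : IsSkewCell lam mu t e) (htb : InBand i (T t e)) (htx : t ≤ x)
    (v r : ℕ) : cnt lam mu S' v r = cnt lam mu S v r := by
  simp only [InBand] at *
  have hxy : x < y := by
    by_contra hlt
    have := hT _ _ _ _ hy hx (by omega) le_rfl
    omega
  by_cases hv : v = i ∨ v = i + 1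
  swap
  · unfold cnt
    congr 1
    apply Finset.filter_congr
    intro c _
    rw [contr_nonband (i := i) band nonband hv, contr_nonband (i := i) band' nonband' hv]
  have hxe : IsSkewCell lam mu x e := cell_convex ht hx htx le_rfl le_rfl (by omega)
  have hTxe : T x e = i := by
    have h1 := hT _ _ _ _ ht hxe htx le_rfl
    have h2 := hT _ _ _ _ hxe hx le_rfl (by omega)
    omega
  rcases hv with rfl | rfl
  · -- the letter `i`
    unfold cnt
    apply Finset.card_equiv (Equiv.swap e (e + 1))
    intro c
    have hmem : ∀ S c, c ∈ (Finset.range (lam.rowLen 0)).filter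
        (fun c => Contr lam mu S v r c) ↔ Contr lam mu S v r c := by
      intro S c
      simp only [Finset.mem_filter, Finset.mem_range]
      exact ⟨fun h => h.2, fun h => ⟨cell_col h.1, h⟩⟩
    rw [hmem, hmem]
    by_cases hce : c = e
    · subst hce
      rw [Equiv.swap_apply_left]
      have hS' : Contr lam mu S' v r c ↔ r = x := by
        constructor
        · rintro ⟨h1, h2, h3⟩
          have hb := (band' r c h1).1 (Or.inl h2)
          have h4 := he r h1 hb
          have h5 : r ≤ x := by
            by_contra hgt; rw [if_neg hgt] at h4; omega
          by_contra hne
          have hc1 : IsSkewCell lam mu (r + 1) c :=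
            cell_convex h1 hxe (by omega) (by omega) le_rfl le_rfl
          have h6 := hT _ _ _ _ h1 hc1 (by omega) le_rfl
          have h7 := hT _ _ _ _ hc1 hxe (by omega) le_rfl
          have h8 := he (r + 1) hc1 (by omega)
          rw [if_pos (by omega)] at h8
          exact h3 ⟨hc1, h8⟩
        · rintro rfl
          refine ⟨hxe, ?_, ?_⟩
          · rw [he r hxe (by omega), if_pos le_rfl]
          · rintro ⟨h1, h2⟩
            have hb := (band' _ c h1).1 (Or.inl h2)
            have h4 := he _ h1 hb
            rw [if_neg (by omega)] at h4
            omega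
      have hS : Contr lam mu S v r (c + 1) ↔ r = x := by
        constructor
        · rintro ⟨h1, h2, h3⟩
          rw [right _ _ (by omega)] at h2 h3
          have h4 := hxmax r h1 h2
          by_contra hne
          have hc1 : IsSkewCell lam mu (r + 1) (c + 1) :=
            cell_convex h1 hx (by omega) (by omega) le_rfl le_rfl
          have h6 := hT _ _ _ _ h1 hc1 (by omega) le_rfl
          have h7 := hT _ _ _ _ hc1 hx (by omega) le_rfl
          exact h3 ⟨hc1, by omega⟩
        · rintro rfl
          refine ⟨hx, by rw [right _ _ (by omega)]; exact hxv, ?_⟩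
          rintro ⟨h1, h2⟩
          rw [right _ _ (by omega)] at h2
          have := hxmax _ h1 h2
          omega
      rw [hS', hS]
    · by_cases hce1 : c = e + 1
      · subst hce1
        rw [Equiv.swap_apply_right]
        constructor
        · rintro ⟨h1, h2, h3⟩
          have hb := (band' _ _ h1).1 (Or.inl h2)
          have := he1 _ h1 hb
          omega
        · rintro ⟨h1, h2, h3⟩
          have hb := (band _ _ h1).1 (Or.inl h2)
          have := high _ h1 hb
          omega
      · rw [Equiv.swap_apply_of_ne_of_ne hce hce1]
        unfold Contr
        rw [hout _ _ hce hce1, hout _ _ hce hce1]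
  · -- the letter `i+1`
    unfold cnt
    congr 1
    apply Finset.filter_congr
    intro c _
    by_cases hce : c = e
    · subst hce
      constructor
      · rintro ⟨h1, h2, h3⟩
        have hb := (band' r c h1).1 (Or.inr h2)
        have h4 := he r h1 hb
        have h5 : x < r := by
          by_contra hgt; rw [if_pos (by omega)] at h4; omega
        refine ⟨h1, high r h1 hb, ?_⟩
        rintro ⟨h6, h7⟩
        have hb6 := (band _ c h6).1 (Or.inr h7)
        have := he _ h6 hb6
        rw [if_neg (by omega)] at this
        exact h3 ⟨h6, this⟩
      · rintro ⟨h1, h2, h3⟩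
        have hb := (band r c h1).1 (Or.inr h2)
        have h5 : x < r := by
          by_contra hgt
          have hc1 : IsSkewCell lam mu (r + 1) c :=
            cell_convex h1 hy (by omega) (by omega) le_rfl (by omega)
          have h6 := hT _ _ _ _ h1 hc1 (by omega) le_rfl
          have h7 := hT _ _ _ _ hc1 hy (by omega) (by omega)
          exact h3 ⟨hc1, high _ hc1 (by omega)⟩
        refine ⟨h1, ?_, ?_⟩
        · rw [he r h1 hb, if_neg (by omega)]
        · rintro ⟨h6, h7⟩
          have hb6 := (band' _ c h6).1 (Or.inr h7)
          exact h3 ⟨h6, high _ h6 hb6⟩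
    · by_cases hce1 : c = e + 1
      · subst hce1
        constructor
        · rintro ⟨h1, h2, h3⟩
          have hb := (band' _ _ h1).1 (Or.inr h2)
          have h4 : T r (e + 1) = i + 1 := by
            rcases hb with hb | hb
            · exfalso
              have := hxmax r h1 hb
              have hc1 : IsSkewCell lam mu (r + 1) (e + 1) :=
                cell_convex h1 hy (by omega) (by omega) le_rfl le_rfl
              have h6 := hT _ _ _ _ h1 hc1 (by omega) le_rfl
              have h7 := hT _ _ _ _ hc1 hy (by omega) (by omega)
              exact h3 ⟨hc1, he1 _ hc1 (by omega)⟩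
            · exact hb
          refine ⟨h1, by rw [right _ _ (by omega)]; exact h4, ?_⟩
          rintro ⟨h6, h7⟩
          rw [right _ _ (by omega)] at h7
          exact h3 ⟨h6, he1 _ h6 (Or.inr h7)⟩
        · rintro ⟨h1, h2, h3⟩
          rw [right _ _ (by omega)] at h2 h3
          refine ⟨h1, he1 _ h1 (Or.inr h2), ?_⟩
          rintro ⟨h6, h7⟩
          have hb := (band' _ _ h6).1 (Or.inr h7)
          have h8 := hT _ _ _ _ h1 h6 (by omega) le_rfl
          exact h3 ⟨h6, by omega⟩
      · unfold Contr
        rw [hout _ _ hce hce1, hout _ _ hce hce1]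

lemma inv_step {i : ℕ} {T S0 S S' : ℕ → ℕ → ℕ} {M : ℤ} {e : ℕ} (hT : Mono lam mu T)
    (hmax : ∀ q, dcol i lam mu T q ≤ M)
    (h : Inv i lam mu T S0 S M e) (hs : DRStep i lam mu S S') :
    ∃ e', Inv i lam mu T S0 S' M e' := by
  have hdesc : ∀ r c, IsDescent i lam mu S r c → c = e := by
    rintro r c ⟨h1, h2, h3, h4⟩
    by_contra hne
    have := h.rows r c hne h1 h2
    omega
  have hcol : ∀ v, ColHasVal lam mu S (e + 1) v ↔ ColHasVal lam mu T (e + 1) v := by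
    intro v
    rw [colHas_iff, colHas_iff]
    simp only [h.right _ (e + 1) (by omega)]
  obtain ⟨c, hs | hs | hs⟩ := hs
  · obtain ⟨h1, h2, ⟨t, ht⟩, hfr, h5, h6⟩ := hs
    obtain rfl := hdesc t c ht
    have hmix : IsMixedCol i lam mu T (c + 1) := ⟨(hcol i).1 h2.1, (hcol (i + 1)).1 h2.2⟩
    obtain ⟨⟨hx, hxv⟩, hxmax⟩ := lowestLow_spec i S (c + 1) h2.1
    set x := lowestLow i lam mu S (c + 1) with hxdef
    rw [h.right _ _ (by omega)] at hxv
    have hxmax' : ∀ r, IsSkewCell lam mu r (c + 1) → T r (c + 1) = i → r ≤ x := by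
      intro r hr1 hr2
      exact hxmax r hr1 (by rw [h.right _ _ (by omega)]; exact hr2)
    obtain ⟨y, hy, hyv⟩ := (colHas_iff T (c + 1) (i + 1)).1 hmix.2
    have htT : T t (c + 1) = i := by rw [← h.right _ _ (by omega)]; exact ht.2.2.2
    have htx : t ≤ x := hxmax' t ht.2.1 htT
    have htb : InBand i (T t c) := (h.band t c ht.1).1 (Or.inr ht.2.2.1)
    have hout : ∀ r c', c' ≠ c → c' ≠ c + 1 → S' r c' = S r c' := by
      intro r c' h1 h2
      exact hfr r c' (Or.inl (by tauto))
    have hnb : ∀ r c', IsSkewCell lam mu r c' → ¬ InBand i (T r c') → S' r c' = T r c' := by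
      intro r c' hc hb
      rw [← h.nonband r c' hc hb]
      exact hfr r c' (Or.inr (fun hh => hb ((h.band r c' hc).1 hh.2)))
    have he : ∀ r, IsSkewCell lam mu r c → InBand i (T r c) →
        S' r c = if r ≤ x then i else i + 1 := fun r hr hb => h5 r hr ((h.band _ _ hr).2 hb)
    have he1 : ∀ r, IsSkewCell lam mu r (c + 1) → InBand i (T r (c + 1)) → S' r (c + 1) = i + 1 :=
      fun r hr hb => h6 r hr ((h.band _ _ hr).2 hb)
    have hband' : ∀ r c', IsSkewCell lam mu r c' → (InBand i (S' r c') ↔ InBand i (T r c')) := by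
      intro r c' hc
      by_cases hb : InBand i (T r c')
      · refine ⟨fun _ => hb, fun _ => ?_⟩
        by_cases h1 : c' = c
        · subst h1
          rw [he r hc hb]
          split_ifs
          · exact Or.inl rfl
          · exact Or.inr rfl
        · by_cases h2 : c' = c + 1
          · subst h2; exact Or.inr (he1 r hc hb)
          · rw [hout r c' h1 h2]; exact (h.band r c' hc).2 hb
      · rw [hnb r c' hc hb]
    have hright' : ∀ r c', c + 1 < c' → S' r c' = T r c' := by
      intro r c' hc
      rw [hout r c' (by omega) (by omega), h.right r c' (by omega)]
    have hprev : ∀ r, IsSkewCell lam mu r c → IsSkewCell lam mu r (c + 1) →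
        S' r c ≤ T r (c + 1) := by
      intro r hr hr1
      have h7 := hT _ _ _ _ hr hr1 le_rfl (by omega : c ≤ c + 1)
      by_cases hb : InBand i (T r c)
      · have h8 := he r hr hb
        rw [inBand_iff] at hb
        split_ifs at h8 with hle
        · omega
        · have : T r (c + 1) ≠ i := fun e => hle (hxmax' r hr1 e)
          omega
      · rw [hnb r c hr hb]; exact h7
    refine ⟨c + 1, hband', hnb, hright', he1, ?_, ?_, ?_, ?_⟩
    · intro r c' hne hc hc1
      by_cases hcc : c' = c
      · subst hcc
        refine (hprev r hc hc1).trans ?_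
        by_cases hb : InBand i (T r (c' + 1))
        · rw [he1 r hc1 hb]
          rw [inBand_iff] at hb; omega
        · rw [hnb _ _ hc1 hb]
      · by_cases hcc1 : c' + 1 = c
        · have h7 : S' r c' = S r c' := hout r c' (by omega) (by omega)
          rw [hcc1] at hc1 ⊢
          have h8 := h.prevT r c' hcc1 hc hc1
          rw [h7]
          by_cases hb : InBand i (T r c)
          · rw [he r hc1 hb]
            split_ifs with hle
            · have hcell : IsSkewCell lam mu r (c + 1) :=
                cell_convex hc1 hx le_rfl hle (by omega) le_rfl
              have h9 := hT _ _ _ _ hc1 hx hle (by omega : c ≤ c + 1)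
              omega
            · rw [inBand_iff] at hb; omega
          · rw [hnb r c hc1 hb]; exact h8
        · rw [hout r c' hcc hne, hout r (c' + 1) hcc1 (by omega)]
          exact h.rows r c' hcc hc hc1
    · intro r c' hcc hc hc1
      obtain rfl : c' = c := by omega
      exact hprev r hc hc1
    · intro v r
      rw [← h.counts v r]
      exact step_counts hT h.band h.nonband h.right h.high hband' hnb hout he he1 hx hxv hxmax'
        y hy hyv t ht.1 htb htx v r
    · rw [dcol_succ, h.dval, if_neg (fun hh => hh.2 hmix.2), if_neg (fun hh => hh.2 hmix.1)]
      ring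
  · obtain ⟨h1, _, ⟨t, ht⟩, _⟩ := hs
    obtain rfl := hdesc t c ht
    obtain ⟨r, hr, hrv⟩ := (colHas_iff S c i).1 h1.1
    have := h.high r hr ((h.band r c hr).1 (Or.inl hrv))
    omega
  · obtain ⟨_, h1, ⟨t, ht⟩, _⟩ := hs
    obtain rfl := hdesc t c ht
    have hlow : IsPureLow i lam mu T (c + 1) :=
      ⟨(hcol i).1 h1.1, fun hh => h1.2 ((hcol (i + 1)).2 hh)⟩
    have h2 := hmax (c + 1 + 1)
    rw [dcol_succ, h.dval, if_pos hlow, if_neg (fun hh => hh.2 hlow.1)] at h2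
    omega

lemma inv_raise {i : ℕ} {T : ℕ → ℕ → ℕ} {M : ℤ} {c : ℕ} (hT : Mono lam mu T)
    (hlow : IsPureLow i lam mu T c) (hd : dcol i lam mu T (c + 1) = M) :
    Inv i lam mu T (raiseCol i lam mu T c) (raiseCol i lam mu T c) M c := by
  have hne : ∀ r c', c' ≠ c → raiseCol i lam mu T c r c' = T r c' := by
    intro r c' h; simp [raiseCol, h]
  have hc : ∀ r, IsSkewCell lam mu r c →
      raiseCol i lam mu T c r c = if T r c = i then i + 1 else T r c := by
    intro r h; simp [raiseCol, h]
  refine ⟨?_, ?_, ?_, ?_, ?_, ?_, fun _ _ => rfl, hd⟩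
  · intro r c' h
    by_cases hcc : c' = c
    · subst hcc
      rw [hc r h, inBand_iff, inBand_iff]
      split_ifs <;> omega
    · rw [hne r c' hcc]
  · intro r c' h hb
    rw [inBand_iff] at hb
    by_cases hcc : c' = c
    · subst hcc
      rw [hc r h, if_neg (by omega)]
    · exact hne r c' hcc
  · intro r c' h
    exact hne r c' (by omega)
  · intro r h hb
    rw [inBand_iff] at hb
    rw [hc r h]
    split_ifs <;> omega
  · intro r c' h h1 h2
    rw [hne r c' h]
    have h3 := hT _ _ _ _ h1 h2 le_rfl (by omega : c' ≤ c' + 1)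
    by_cases hcc : c' + 1 = c
    · rw [hcc] at h2 h3 ⊢
      rw [hc r h2]
      split_ifs <;> omega
    · rw [hne r _ hcc]; exact h3
  · intro r c' h h1 h2
    rw [hne r c' (by omega)]
    exact hT _ _ _ _ h1 h2 le_rfl (by omega)

lemma raise_counts {i : ℕ} {T : ℕ → ℕ → ℕ} {c r0 : ℕ} (hT : Mono lam mu T)
    (hlow : IsPureLow i lam mu T c) (hr0 : Contr lam mu T i r0 c) (v r : ℕ) :
    cnt lam mu (raiseCol i lam mu T c) v r + (if v = i ∧ r = r0 then 1 else 0) =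
      cnt lam mu T v r + (if v = i + 1 ∧ r = r0 then 1 else 0) := by
  have hne : ∀ r c', c' ≠ c → raiseCol i lam mu T c r c' = T r c' := by
    intro r c' h; simp [raiseCol, h]
  have hc : ∀ r, IsSkewCell lam mu r c →
      raiseCol i lam mu T c r c = if T r c = i then i + 1 else T r c := by
    intro r h; simp [raiseCol, h]
  have hno : ∀ r, IsSkewCell lam mu r c → T r c ≠ i + 1 :=
    fun r h e => hlow.2 ((colHas_iff T c (i + 1)).2 ⟨r, h, e⟩)
  have hcn : ∀ v r c', c' ≠ c →
      (Contr lam mu (raiseCol i lam mu T c) v r c' ↔ Contr lam mu T v r c') := by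
    intro v r c' h
    unfold Contr
    rw [hne _ _ h, hne _ _ h]
  have hci : ∀ r, ¬ Contr lam mu (raiseCol i lam mu T c) i r c := by
    rintro r ⟨h1, h2, _⟩
    rw [hc r h1] at h2
    split_ifs at h2 <;> omega
  have hci1 : ∀ r, Contr lam mu (raiseCol i lam mu T c) (i + 1) r c ↔ Contr lam mu T i r c := by
    have key : ∀ r, IsSkewCell lam mu r c →
        (raiseCol i lam mu T c r c = i + 1 ↔ T r c = i) := by
      intro r h
      have := hno r h
      rw [hc r h]
      split_ifs <;> omega
    intro r
    unfold Contr
    constructor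
    · rintro ⟨h1, h2, h3⟩
      exact ⟨h1, (key r h1).1 h2, fun h => h3 ⟨h.1, (key _ h.1).2 h.2⟩⟩
    · rintro ⟨h1, h2, h3⟩
      exact ⟨h1, (key r h1).2 h2, fun h => h3 ⟨h.1, (key _ h.1).1 h.2⟩⟩
  have hcv : ∀ v r, v ≠ i → v ≠ i + 1 →
      (Contr lam mu (raiseCol i lam mu T c) v r c ↔ Contr lam mu T v r c) := by
    intro v r hv1 hv2
    have key : ∀ r, IsSkewCell lam mu r c →
        (raiseCol i lam mu T c r c = v ↔ T r c = v) := by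
      intro r h
      rw [hc r h]
      split_ifs <;> omega
    unfold Contr
    constructor
    · rintro ⟨h1, h2, h3⟩
      exact ⟨h1, (key r h1).1 h2, fun h => h3 ⟨h.1, (key _ h.1).2 h.2⟩⟩
    · rintro ⟨h1, h2, h3⟩
      exact ⟨h1, (key r h1).2 h2, fun h => h3 ⟨h.1, (key _ h.1).1 h.2⟩⟩
  have hTr : ∀ r, Contr lam mu T i r c ↔ r = r0 := fun r =>
    ⟨fun h => contr_unique hT h hr0, fun h => h ▸ hr0⟩
  have hTi1 : ∀ r, ¬ Contr lam mu T (i + 1) r c := fun r h => hno r h.1 h.2.1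
  have hcN : c ∈ Finset.range (lam.rowLen 0) := Finset.mem_range.2 (cell_col hr0.1)
  have hsum : ∀ S, cnt lam mu S v r = (if Contr lam mu S v r c then 1 else 0) +
      (((Finset.range (lam.rowLen 0)).erase c).filter fun c => Contr lam mu S v r c).card := by
    intro S
    unfold cnt
    conv_lhs => rw [← Finset.insert_erase hcN, Finset.filter_insert]
    split_ifs
    · rw [Finset.card_insert_of_notMem (by simp)]; omega
    · omega
  have herase : (((Finset.range (lam.rowLen 0)).erase c).filter
      fun c' => Contr lam mu (raiseCol i lam mu T c) v r c') =
      (((Finset.range (lam.rowLen 0)).erase c).filter fun c' => Contr lam mu T v r c') := by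
    apply Finset.filter_congr
    intro c' hc'
    exact hcn v r c' (Finset.ne_of_mem_erase hc')
  rw [hsum, hsum T, herase]
  by_cases hv1 : v = i
  · subst hv1
    rw [if_neg (hci r)]
    simp only [hTr]
    simp; omega
  · by_cases hv2 : v = i + 1
    · subst hv2
      rw [if_neg (hTi1 r)]
      simp only [hci1, hTr]
      simp; omega
    · simp only [hcv v r hv1 hv2]
      simp [hv1, hv2]

lemma inv_final {i : ℕ} {T S0 S : ℕ → ℕ → ℕ} {M : ℤ} {e : ℕ} (hT : Mono lam mu T)
    (h : Inv i lam mu T S0 S M e) (hn : NoDescent i lam mu S) (r c : ℕ)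
    (h1 : IsSkewCell lam mu r c) (h2 : IsSkewCell lam mu r (c + 1)) : S r c ≤ S r (c + 1) := by
  by_cases hc : c = e
  · subst hc
    have h3 := hT _ _ _ _ h1 h2 le_rfl (by omega : c ≤ c + 1)
    have hr := h.right r (c + 1) (by omega)
    by_cases hb : InBand i (T r c)
    · have h4 := h.high r h1 hb
      have h5 : S r (c + 1) ≠ i := fun e => hn r c ⟨h1, h2, h4, e⟩
      rw [inBand_iff] at hb
      omega
    · rw [h.nonband r c h1 hb, hr]; exact h3
  · exact h.rows r c hc h1 h2

lemma split_last (i : ℕ) (l : List ℕ) (h : i ∈ l) :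
    ∃ S1 S2, l = S1 ++ i :: S2 ∧ i ∉ S2 := by
  induction l with
  | nil => simp at h
  | cons a l ih =>
    by_cases hl : i ∈ l
    · obtain ⟨S1, S2, rfl, h2⟩ := ih hl
      exact ⟨a :: S1, S2, rfl, h2⟩
    · have : i = a := by simpa [hl] using h
      subst this
      exact ⟨[], l, rfl, hl⟩

lemma eq_of_counts {l1 l2 : List ℕ} (h1 : l1.Pairwise (· ≤ ·)) (h2 : l2.Pairwise (· ≤ ·))
    (h : ∀ v, l1.count v = l2.count v) : l1 = l2 :=
  (List.perm_iff_count.2 h).eq_of_pairwise (fun _ _ _ _ => le_antisymm) h1 h2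

/-- Everything about the nonzero case. -/
lemma main_some {i : ℕ} {T : ℕ → ℕ → ℕ} (hT : Mono lam mu T) {p c : ℕ}
    (hp : (unmatchedCloses i (colWord i lam mu T)).getLast? = some p)
    (hc : (pureCols i lam mu T)[p]? = some c) :
    Fop i (readingWord lam mu T) ≠ none ∧
    ∀ T', Relation.ReflTransGen (DRStep i lam mu) (raiseCol i lam mu T c) T' →
      NoDescent i lam mu T' → Fop i (readingWord lam mu T) = some (readingWord lam mu T') := by
  obtain ⟨_, hw, hM1, hM2, hM3⟩ := last_unmatched_max i _ p hp
  obtain ⟨hpure, hlen, hlen1⟩ := pureCols_index i T hc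
  have hlow : IsPureLow i lam mu T c := by
    by_contra hnot
    unfold colWord at hw
    rw [List.getElem?_map, hc] at hw
    simp [hnot] at hw
  set M := prefD i (colWord i lam mu T) (p + 1) with hMdef
  have hdM : dcol i lam mu T (c + 1) = M := by rw [← prefD_colWord, hlen1]
  have hmax : ∀ q, dcol i lam mu T q ≤ M := fun q => by rw [← prefD_colWord]; exact hM3 _
  have hlt : ∀ q ≤ c, dcol i lam mu T q ≤ M - 1 := fun q hq => by
    rw [← prefD_colWord]
    have h1 := (pcInit (lam := lam) (mu := mu) i T hq).length_le
    have := hM2 (pc i lam mu T q).length (by omega)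
    omega
  obtain ⟨t, ht, htv⟩ := (colHas_iff T c i).1 hlow.1
  obtain ⟨r0, _, hr0⟩ := exists_contr T ht htv
  have hsorted : ∀ r, (rowWord lam mu T r).Pairwise (· ≤ ·) := fun r =>
    sorted_rowWord (fun c h1 h2 => hT _ _ _ _ h1 h2 le_rfl (by omega))
  have hall : ∀ s < lam.colLen 0, Drow i (lam.colLen 0) (rowWord lam mu T) s ≤ M := by
    intro s _
    obtain ⟨q, hq, _⟩ := Drow_le_exists hT i s
    exact hq.trans (hmax q)
  have hi : i ∈ rowWord lam mu T r0 := by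
    rw [← List.count_pos_iff, count_rowWord]
    unfold cnt
    rw [Finset.card_pos]
    exact ⟨c, by simp only [Finset.mem_filter, Finset.mem_range]; exact ⟨cell_col hr0.1, hr0⟩⟩
  obtain ⟨S1, S2, hS, hS2⟩ := split_last i _ hi
  have hso := hsorted r0
  rw [hS, List.pairwise_append, List.pairwise_cons] at hso
  obtain ⟨hs1, ⟨hs2, hs3⟩, hs4⟩ := hso
  have hS1 : i + 1 ∉ S1 := fun h => by
    have := hs4 _ h i (by simp); omega
  have hF := Fop_rows_some i (lam.colLen 0) (rowWord lam mu T) r0 (cell_row hr0.1) M hM1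
    (le_antisymm (hall _ (cell_row hr0.1)) (hdM ▸ Drow_ge hT i r0 c hlow hr0))
    (fun s hs _ => Drow_lt hT i r0 c hr0 (M - 1) hlt s hs) hall S1 S2 hS hS1 hS2
  rw [← readingWord_eq] at hF
  refine ⟨by rw [hF]; simp, fun T' hrt hnd => ?_⟩
  have hinv : ∃ e, Inv i lam mu T (raiseCol i lam mu T c) T' M e := by
    clear hnd
    induction hrt with
    | refl => exact ⟨c, inv_raise hT hlow hdM⟩
    | tail _ hst ih =>
      obtain ⟨e, he⟩ := ih
      exact inv_step hT hmax he hst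
  obtain ⟨e, he⟩ := hinv
  rw [hF, readingWord_eq]
  have hsorted' : ∀ r, (rowWord lam mu T' r).Pairwise (· ≤ ·) := fun r =>
    sorted_rowWord (fun c h1 h2 => inv_final hT he hnd r c h1 h2)
  congr 2
  funext r
  have hcounts : ∀ v, (rowWord lam mu T' r).count v + (if v = i ∧ r = r0 then 1 else 0) =
      (rowWord lam mu T r).count v + (if v = i + 1 ∧ r = r0 then 1 else 0) := by
    intro v
    rw [count_rowWord, count_rowWord, he.counts]
    exact raise_counts hT hlow hr0 v r
  by_cases hr : r = r0
  · subst hr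
    rw [if_pos rfl]
    apply eq_of_counts _ (hsorted' r)
    · intro v
      have h1 := hcounts v
      rw [hS, List.count_append, List.count_cons] at h1
      rw [List.count_append, List.count_cons]
      simp only [beq_iff_eq, and_true] at h1 ⊢
      split_ifs at h1 ⊢ <;> omega
    · rw [List.pairwise_append, List.pairwise_cons]
      refine ⟨hs1, ⟨?_, hs3⟩, ?_⟩
      · intro a ha
        have h1 := hs2 a ha
        have h2 : a ≠ i := fun e => hS2 (e ▸ ha)
        omega
      · intro a ha b hb
        rw [List.mem_cons] at hb
        rcases hb with rfl | hb
        · have := hs4 a ha i (by simp); omega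
        · exact hs4 a ha b (by simp [hb])
  · rw [if_neg hr]
    apply eq_of_counts (hsorted r) (hsorted' r)
    intro v
    have h1 := hcounts v
    simp only [hr, and_false, if_false, add_zero] at h1
    exact h1.symm

end Steps
end FiAux

/-- For every reverse plane partition `T` of shape `lam/mu` with entries in
`[m]`, `F_i(r(T)) = r(f_i(T))`: `f_i(T) = 0` if and only if `F_i(r(T)) = 0`, and whenever
`f_i(T) = T' ≠ 0`, `F_i(r(T)) = r(T')`. -/
theorem Fi_readingWord (lam mu : YoungDiagram) (hsub : mu ≤ lam)
    (m : ℕ) (hm : 2 ≤ m) (i : ℕ) (hi : 1 ≤ i) (him : i < m)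
    (T : ℕ → ℕ → ℕ) (hT : IsSkewRPP lam mu m T) :
    (fiZero i lam mu T ↔ Fop i (readingWord lam mu T) = none) ∧
    (∀ T', fiRel i lam mu T T' →
      Fop i (readingWord lam mu T) = some (readingWord lam mu T')) := by
  have hmono := FiAux.mono_of_rpp hT
  refine ⟨⟨fun h => ?_, fun h => ?_⟩, ?_⟩
  · rw [FiAux.readingWord_eq]
    apply FiAux.Fop_rows_none
    intro r _
    obtain ⟨q, hq, _⟩ := FiAux.Drow_le_exists hmono i r
    refine hq.trans ?_
    rw [← FiAux.prefD_colWord]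
    exact (FiAux.unmatched_nil_iff i _).1 h _
  · by_contra hne
    rcases hp : (unmatchedCloses i (colWord i lam mu T)).getLast? with _ | p
    · exact hne (List.getLast?_eq_none_iff.1 hp)
    · have hlt := (FiAux.last_unmatched_max i _ p hp).1
      have hlt' : p < (pureCols i lam mu T).length := by simpa [colWord] using hlt
      exact (FiAux.main_some hmono hp (List.getElem?_eq_getElem hlt')).1 h
  · rintro T' ⟨p, c, hp, hc, hrt, hnd⟩
    exact (FiAux.main_some hmono hp hc).2 T' hrt hnd
end
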